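/- arXiv:2403.15963 — 2 statements merged into one kernel-verified Lean document; each statement's English description precedes it below -/
import Mathlib

section
/- (Bridging lemma.) Let θ₁ < θ₂ with (θ₁,θ₂) ∩ E = ∅, and let λ̄ ∈ ℝ and f₁, f₂ ∈ S_st^{λ̄} with 𝔼[f₁(0,·)] = θ₁ and 𝔼[f₂(0,·)] = θ₂. Then there exists a measurable Ω̄ ⊆ Ω with ℙ(Ω̄) = 1 such that for every ω ∈ Ω̄ and every δ ∈ (0,1) ∩ ℚ: (a) there exist z₁ < z₂ and a C¹ function g on [z₁,z₂] with a(x,ω)g′(x) + H(g(x),x,ω) = λ̄ + δ for all x ∈ [z₁,z₂], g(z₁) = f₁(z₁,ω) and g(z₂) = f₂(z₂,ω); (b) there exist w₁ < w₂ and a C¹ function h on [w₁,w₂] with a(x,ω)h′(x) + H(h(x),x,ω) = λ̄ − δ for all x ∈ [w₁,w₂], h(w₁) = f₂(w₁,ω) and h(w₂) = f₁(w₂,ω). -/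
open MeasureTheory Filter Set

structure HJSetting {Ω : Type} [MeasurableSpace Ω] (P : Measure Ω) (τ : ℝ → Ω → Ω)
    (a : ℝ → Ω → ℝ) (H : ℝ → ℝ → Ω → ℝ) (G_L G_U : ℝ → ℝ) : Prop where
  prob : IsProbabilityMeasure P
  meas_tau : Measurable fun q : ℝ × Ω => τ q.1 q.2
  mp_tau : ∀ x, MeasurePreserving (τ x) P P
  tau_zero : ∀ ω, τ 0 ω = ω
  tau_add : ∀ x y ω, τ (x + y) ω = τ x (τ y ω)
  ergodic : ∀ A : Set Ω, MeasurableSet A → (∀ x, τ x ⁻¹' A = A) → P A = 0 ∨ P A = 1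
  meas_a : Measurable fun q : ℝ × Ω => a q.1 q.2
  a_pos : ∀ x ω, 0 < a x ω
  a_le_one : ∀ x ω, a x ω ≤ 1
  a_stat : ∀ x ω, a x ω = a 0 (τ x ω)
  a_sqrt_lip : ∃ κ > (0:ℝ), ∀ x ω, |Real.sqrt (a x ω) - Real.sqrt (a 0 ω)| ≤ κ * |x|
  meas_H : Measurable fun q : ℝ × ℝ × Ω => H q.1 q.2.1 q.2.2
  H_stat : ∀ p x ω, H p x ω = H p 0 (τ x ω)
  GL_cont : Continuous G_L
  GU_cont : Continuous G_U
  GL_even : ∀ p, G_L (-p) = G_L p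
  GU_even : ∀ p, G_U (-p) = G_U p
  GL_mono : MonotoneOn G_L (Ici 0)
  GU_mono : MonotoneOn G_U (Ici 0)
  GL_coercive : Tendsto G_L atTop atTop
  GU_coercive : Tendsto G_U atTop atTop
  H_lower : ∀ p ω, G_L p ≤ H p 0 ω
  H_upper : ∀ p ω, H p 0 ω ≤ G_U p
  H_lip : ∀ R > (0:ℝ), ∃ K > (0:ℝ), ∀ p q ω, |p| ≤ R → |q| ≤ R →
      |H p 0 ω - H q 0 ω| ≤ K * |p - q|
  H_mod : ∀ R > (0:ℝ), ∃ m : ℝ → ℝ, (∀ r, 0 ≤ m r) ∧ MonotoneOn m (Ici 0) ∧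
      Tendsto m (nhdsWithin 0 (Ioi 0)) (nhds 0) ∧
      ∀ p x ω, |p| ≤ R → |H p x ω - H p 0 ω| ≤ m |x|

/-- `f` is a stationary solution of `a(x,ω) f' + H(f,x,ω) = lam`. -/
def StatSol {Ω : Type} [MeasurableSpace Ω] (P : Measure Ω) (τ : ℝ → Ω → Ω)
    (a : ℝ → Ω → ℝ) (H : ℝ → ℝ → Ω → ℝ) (lam : ℝ) (f : ℝ → Ω → ℝ) : Prop :=
  (Measurable fun q : ℝ × Ω => f q.1 q.2) ∧
  (∀ x ω, f x ω = f 0 (τ x ω)) ∧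
  (∀ ω, ContDiff ℝ 1 fun x => f x ω) ∧
  (∀ᵐ ω ∂P, (∃ M, ∀ x, |f x ω| ≤ M) ∧
    ∀ x, a x ω * deriv (fun y => f y ω) x + H (f x ω) x ω = lam)

/-- The set `E` of expectations `𝔼[f(0,·)]` over all stationary solutions `f`. -/
def Eset {Ω : Type} [MeasurableSpace Ω] (P : Measure Ω) (τ : ℝ → Ω → Ω)
    (a : ℝ → Ω → ℝ) (H : ℝ → ℝ → Ω → ℝ) : Set ℝ :=
  {θ | ∃ lam f, StatSol P τ a H lam f ∧ (∫ ω, f 0 ω ∂P) = θ}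

/-- A scalar field on the line that is continuous and, locally uniformly in the first variable,
bounded and Lipschitz in the second one. -/
structure IsTameField (F : ℝ → ℝ → ℝ) : Prop where
  cont : Continuous fun q : ℝ × ℝ => F q.1 q.2
  lip : ∀ T : ℝ, ∃ K : NNReal, ∀ x, |x| ≤ T → LipschitzWith K (F x)
  bdd : ∀ T : ℝ, ∃ B : NNReal, ∀ x, |x| ≤ T → ∀ p, |F x p| ≤ B

/-- A global solution of `u' = F(x, u)`. -/
def IsGlobalSol (F : ℝ → ℝ → ℝ) (u : ℝ → ℝ) : Prop :=
  ∀ x, HasDerivAt u (F x (u x)) x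

/-- The Picard iterates of `u' = F(x, u)`, `u(0) = c`. -/
noncomputable def picardIter (F : ℝ → ℝ → ℝ) (c : ℝ) : ℕ → ℝ → ℝ
  | 0 => fun _ => c
  | n + 1 => ODE.picard F 0 c (picardIter F c n)

/-- The limit of the Picard iterates. -/
noncomputable def picardLimit (F : ℝ → ℝ → ℝ) (c : ℝ) (x : ℝ) : ℝ :=
  limsup (fun n => picardIter F c n x) atTop

theorem IsGlobalSol.continuous {F : ℝ → ℝ → ℝ} {u : ℝ → ℝ} (hu : IsGlobalSol F u) :
    Continuous u :=
  continuous_iff_continuousAt.2 fun x => (hu x).continuousAt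

theorem IsGlobalSol.eq_of_eq {F : ℝ → ℝ → ℝ} (hF : IsTameField F) {u v : ℝ → ℝ}
    (hu : IsGlobalSol F u) (hv : IsGlobalSol F v) {z : ℝ} (h : u z = v z) (x : ℝ) :
    u x = v x := by
  obtain ⟨K, hK⟩ := hF.lip (max |x| |z| + 1)
  have hmem : ∀ y : ℝ, |y| ≤ max |x| |z| →
      y ∈ Ioo (-(max |x| |z| + 1)) (max |x| |z| + 1) := fun y hy =>
    abs_lt.1 (hy.trans_lt (lt_add_one _))
  exact ODE_solution_unique_of_mem_Ioo (v := F) (K := K) (s := fun _ => univ)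
    (fun t ht => (hK t (abs_lt.2 ht).le).lipschitzOnWith)
    (hmem z (le_max_right _ _)) (fun t _ => ⟨hu t, trivial⟩) (fun t _ => ⟨hv t, trivial⟩) h
    (hmem x (le_max_left _ _))

theorem IsGlobalSol.lt_of_lt {F : ℝ → ℝ → ℝ} (hF : IsTameField F) {u v : ℝ → ℝ}
    (hu : IsGlobalSol F u) (hv : IsGlobalSol F v) {z : ℝ} (h : u z < v z) (x : ℝ) :
    u x < v x := by
  by_contra! hx
  obtain ⟨y, -, hy⟩ := isPreconnected_univ.intermediate_value₂ (mem_univ z) (mem_univ x)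
    hu.continuous.continuousOn hv.continuous.continuousOn h.le hx
  exact h.ne (hu.eq_of_eq hF hv hy z)

theorem IsGlobalSol.le_of_le {F : ℝ → ℝ → ℝ} (hF : IsTameField F) {u v : ℝ → ℝ}
    (hu : IsGlobalSol F u) (hv : IsGlobalSol F v) {z : ℝ} (h : u z ≤ v z) (x : ℝ) :
    u x ≤ v x := by
  rcases h.lt_or_eq with h | h
  · exact (hu.lt_of_lt hF hv h x).le
  · exact (hu.eq_of_eq hF hv h x).le

theorem IsTameField.continuous_comp {F : ℝ → ℝ → ℝ} (hF : IsTameField F) {u : ℝ → ℝ}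
    (hu : Continuous u) : Continuous fun x => F x (u x) :=
  hF.cont.comp (continuous_id.prodMk hu)

theorem IsTameField.continuous_picardIter {F : ℝ → ℝ → ℝ} (hF : IsTameField F) (c : ℝ) (n : ℕ) :
    Continuous (picardIter F c n) := by
  induction n with
  | zero => exact continuous_const
  | succ n ih =>
    exact continuous_const.add (intervalIntegral.continuous_primitive
      (fun _ _ => (hF.continuous_comp ih).intervalIntegrable _ _) _)

theorem IsTameField.exists_eq_picard {F : ℝ → ℝ → ℝ} (hF : IsTameField F) (c : ℝ) {T : ℝ}
    (hT : 0 < T) :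
    ∃ α : ℝ → ℝ, α 0 = c ∧ ∀ x ∈ Icc (-T) T, HasDerivWithinAt α (F x (α x)) (Icc (-T) T) x := by
  obtain ⟨K, hK⟩ := hF.lip T
  obtain ⟨B, hB⟩ := hF.bdd T
  have h0 : (0 : ℝ) ∈ Icc (-T) T := ⟨by linarith, hT.le⟩
  have hpl : IsPicardLindelof F (⟨0, h0⟩ : Icc (-T) T) c (B * T.toNNReal) 0 B K :=
    { lipschitzOnWith := fun t ht => (hK t (abs_le.2 ht)).lipschitzOnWith
      continuousOn := fun p _ => (hF.continuous_comp continuous_const).continuousOn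
      norm_le := fun t ht p _ => hB t (abs_le.2 ht) p
      mul_max_le := by simp [hT.le] }
  exact hpl.exists_eq_forall_mem_Icc_hasDerivWithinAt₀

theorem IsTameField.abs_picardIter_sub_le {F : ℝ → ℝ → ℝ} (hF : IsTameField F) {c T : ℝ}
    {α : ℝ → ℝ} (h0 : α 0 = c)
    (hα : ∀ x ∈ Icc (-T) T, HasDerivWithinAt α (F x (α x)) (Icc (-T) T) x) {K : NNReal}
    (hK : ∀ x, |x| ≤ T → LipschitzWith K (F x)) {C : ℝ}
    (hC : ∀ x ∈ Icc (-T) T, |c - α x| ≤ C) (n : ℕ) :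
    ∀ x ∈ Icc (-T) T, |picardIter F c n x - α x| ≤ C * ((K * |x|) ^ n / n.factorial) := by
  induction n with
  | zero => intro x hx; simpa [picardIter] using hC x hx
  | succ n ih =>
    intro x hx
    have hsub : uIcc 0 x ⊆ Icc (-T) T :=
      uIcc_subset_Icc ⟨by linarith [hx.1.trans hx.2, hx.1, hx.2], by linarith [hx.1, hx.2]⟩ hx
    have hαc : ContinuousOn α (uIcc 0 x) :=
      ContinuousOn.mono (fun y hy => (hα y hy).continuousWithinAt) hsub
    have hint : IntervalIntegrable (fun s => F s (α s)) volume 0 x :=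
      (hF.cont.comp_continuousOn (continuousOn_id.prodMk hαc)).intervalIntegrable
    have heq : ODE.picard F 0 (α 0) α x = α x :=
      ODE.picard_eq_of_hasDerivAt (u := univ) hF.cont.continuousOn
        (fun t ht => (hα t (hsub ht)).mono hsub) (mapsTo_univ _ _)
    have hdiff : picardIter F c (n + 1) x - α x
        = ∫ s in (0 : ℝ)..x, (F s (picardIter F c n s) - F s (α s)) := by
      rw [intervalIntegral.integral_sub
        ((hF.continuous_comp (hF.continuous_picardIter c n)).intervalIntegrable _ _) hint, ← heq, h0]
      simp [picardIter]
    rw [hdiff, ← Real.norm_eq_abs, intervalIntegral.norm_integral_eq_norm_integral_uIoc]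
    have hbound : ∀ s ∈ uIoc 0 x, ‖F s (picardIter F c n s) - F s (α s)‖
        ≤ K * (C * (K ^ n / n.factorial)) * |s - 0| ^ n := by
      intro s hs
      have hs' := hsub (uIoc_subset_uIcc hs)
      calc ‖F s (picardIter F c n s) - F s (α s)‖
          ≤ K * ‖picardIter F c n s - α s‖ := (hK s (abs_le.2 hs')).norm_sub_le _ _
        _ ≤ K * (C * ((K * |s|) ^ n / n.factorial)) := by
            gcongr; exact ih s hs'
        _ = _ := by rw [mul_pow, sub_zero]; ring
    refine (norm_integral_le_of_norm_le ?_
      ((ae_restrict_iff' measurableSet_uIoc).2 (Eventually.of_forall hbound))).trans ?_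
    · exact (Continuous.integrableOn_uIoc (by fun_prop))
    · rw [integral_const_mul, integral_pow_abs_sub_uIoc, sub_zero, Nat.factorial_succ]
      push_cast
      apply le_of_eq
      rw [mul_pow]
      field_simp
      ring

theorem IsTameField.tendsto_picardIter {F : ℝ → ℝ → ℝ} (hF : IsTameField F) {c T : ℝ}
    {α : ℝ → ℝ} (h0 : α 0 = c)
    (hα : ∀ x ∈ Icc (-T) T, HasDerivWithinAt α (F x (α x)) (Icc (-T) T) x) {x : ℝ}
    (hx : x ∈ Icc (-T) T) :
    Tendsto (fun n => picardIter F c n x) atTop (nhds (α x)) := by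
  obtain ⟨K, hK⟩ := hF.lip T
  have hcont : ContinuousOn (fun x => |c - α x|) (Icc (-T) T) :=
    (continuousOn_const.sub fun y hy => (hα y hy).continuousWithinAt).abs
  obtain ⟨C, hC⟩ := (isCompact_Icc.image_of_continuousOn hcont).bddAbove
  rw [tendsto_iff_norm_sub_tendsto_zero]
  refine squeeze_zero (fun _ => norm_nonneg _)
    (fun n => hF.abs_picardIter_sub_le h0 hα hK (fun y hy => hC ⟨y, hy, rfl⟩) n x hx) ?_
  simpa using (FloorSemiring.tendsto_pow_div_factorial_atTop (K * |x|)).const_mul C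

theorem IsTameField.picardLimit_eqOn {F : ℝ → ℝ → ℝ} (hF : IsTameField F) (c : ℝ) {T : ℝ}
    (hT : 0 < T) :
    ∃ α : ℝ → ℝ, α 0 = c ∧ (∀ x ∈ Icc (-T) T, HasDerivWithinAt α (F x (α x)) (Icc (-T) T) x) ∧
      EqOn (picardLimit F c) α (Icc (-T) T) := by
  obtain ⟨α, h0, hα⟩ := hF.exists_eq_picard c hT
  exact ⟨α, h0, hα, fun x hx => (hF.tendsto_picardIter h0 hα hx).limsup_eq⟩

theorem IsTameField.picardLimit_zero {F : ℝ → ℝ → ℝ} (hF : IsTameField F) (c : ℝ) :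
    picardLimit F c 0 = c := by
  obtain ⟨α, h0, -, h⟩ := hF.picardLimit_eqOn c one_pos
  rw [h ⟨by norm_num, by norm_num⟩, h0]

theorem IsTameField.isGlobalSol_picardLimit {F : ℝ → ℝ → ℝ} (hF : IsTameField F) (c : ℝ) :
    IsGlobalSol F (picardLimit F c) := by
  intro x
  obtain ⟨α, -, hα, h⟩ := hF.picardLimit_eqOn c (T := |x| + 1) (by positivity)
  have hx : x ∈ Ioo (-(|x| + 1)) (|x| + 1) := abs_lt.1 (lt_add_one _)
  have hx' := Ioo_subset_Icc_self hx
  have hn := Icc_mem_nhds hx.1 hx.2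
  rw [h hx']
  exact ((hα x hx').hasDerivAt hn).congr_of_eventuallyEq (h.eventuallyEq_of_mem hn)

theorem isGlobalSol_of_tendsto {F : ℝ → ℝ → ℝ} (hF : IsTameField F) {ι : Type*} {l : Filter ι}
    [l.NeBot] [l.IsCountablyGenerated] {u : ι → ℝ → ℝ} (hu : ∀ i, IsGlobalSol F (u i))
    {g : ℝ → ℝ} (hg : ∀ x, Tendsto (fun i => u i x) l (nhds (g x))) : IsGlobalSol F g := by
  have hFu : ∀ i, Continuous fun x => F x (u i x) := fun i => hF.continuous_comp (hu i).continuous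
  have key : ∀ a b, Tendsto (fun i => ∫ s in a..b, F s (u i s)) l
      (nhds (∫ s in a..b, F s (g s))) := by
    intro a b
    obtain ⟨B, hB⟩ := hF.bdd (max |a| |b|)
    refine intervalIntegral.tendsto_integral_filter_of_dominated_convergence (fun _ => (B : ℝ))
      (Eventually.of_forall fun i => (hFu i).aestronglyMeasurable)
      (Eventually.of_forall fun i => Eventually.of_forall fun s hs => hB s ?_ _)
      intervalIntegrable_const
      (Eventually.of_forall fun s _ => ?_)
    · exact abs_le.2 (uIcc_subset_Icc (abs_le.1 (le_max_left _ _)) (abs_le.1 (le_max_right _ _))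
        (uIoc_subset_uIcc hs))
    · have hFs : Continuous (F s) := hF.cont.comp (continuous_const.prodMk continuous_id)
      exact (hFs.tendsto (g s)).comp (hg s)
  have hgint : ∀ a b, g b - g a = ∫ s in a..b, F s (g s) := fun a b => by
    refine tendsto_nhds_unique (((hg b).sub (hg a)).congr fun i => ?_) (key a b)
    exact (intervalIntegral.integral_eq_sub_of_hasDerivAt (fun x _ => hu i x)
      ((hFu i).intervalIntegrable _ _)).symm
  have hgc : Continuous g := by
    refine continuous_iff_continuousAt.2 fun x => ?_
    obtain ⟨B, hB⟩ := hF.bdd (|x| + 1)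
    have hx : x ∈ Ioo (-(|x| + 1)) (|x| + 1) := abs_lt.1 (lt_add_one _)
    have hlip : LipschitzOnWith B g (Icc (-(|x| + 1)) (|x| + 1)) := by
      refine LipschitzOnWith.of_dist_le_mul fun y hy w hw => ?_
      rw [Real.dist_eq, Real.dist_eq, hgint w y]
      exact intervalIntegral.norm_integral_le_of_norm_le_const (f := fun s => F s (g s))
        fun s hs => hB s (abs_le.2 (uIcc_subset_Icc hw hy (uIoc_subset_uIcc hs))) _
    exact hlip.continuousOn.continuousAt (Icc_mem_nhds hx.1 hx.2)
  intro x
  have h := (intervalIntegral.integral_hasDerivAt_right (a := 0) (b := x)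
    ((hF.continuous_comp hgc).intervalIntegrable _ _)
    ((hF.continuous_comp hgc).stronglyMeasurableAtFilter _ _)
    (hF.continuous_comp hgc).continuousAt).const_add (g 0)
  refine h.congr_of_eventuallyEq (Eventually.of_forall fun y => ?_)
  simp [← hgint 0 y]

theorem IsGlobalSol.ge_of_barrier {F : ℝ → ℝ → ℝ} {u b b' : ℝ → ℝ} (hu : IsGlobalSol F u)
    (hb : ∀ x, HasDerivAt b (b' x) x) (hlt : ∀ x, b' x < F x (b x)) {z x : ℝ} (hz : b z ≤ u z)
    (hx : z ≤ x) : b x ≤ u x :=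
  image_le_of_deriv_right_lt_deriv_boundary' (f := b) (f' := b') (B := u) (a := z) (b := x)
    (fun y _ => (hb y).continuousAt.continuousWithinAt) (fun y _ => (hb y).hasDerivWithinAt) hz
    hu.continuous.continuousOn (fun y _ => (hu y).hasDerivWithinAt)
    (fun y _ hy => by rw [← hy]; exact hlt y) ⟨hx, le_rfl⟩

theorem IsGlobalSol.barrier_ne {F : ℝ → ℝ → ℝ} {u b b' : ℝ → ℝ} (hu : IsGlobalSol F u)
    (hb : ∀ x, HasDerivAt b (b' x) x) (hlt : ∀ x, b' x < F x (b x))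
    (h : (∀ x, b x ≤ u x) ∨ ∀ x, u x ≤ b x) (x : ℝ) : b x ≠ u x := by
  intro hx
  have hd : HasDerivAt (fun y => u y - b y) (F x (u x) - b' x) x := (hu x).sub (hb x)
  have hext : IsLocalExtr (fun y => u y - b y) x := by
    rcases h with h | h
    · exact Or.inl (Eventually.of_forall fun y => by simpa [hx] using h y)
    · exact Or.inr (Eventually.of_forall fun y => by simpa [hx] using h y)
  have := hext.hasDerivAt_eq_zero hd
  have := hlt x
  rw [hx] at this
  linarith

/-- Solutions started on a strict lower barrier at times going to `-∞` converge, as long as they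
stay below an upper bound. -/
theorem tendsto_backward_iSup {F : ℝ → ℝ → ℝ} (hF : IsTameField F) {b b' B : ℝ → ℝ}
    (hb : ∀ x, HasDerivAt b (b' x) x) (hlt : ∀ x, b' x < F x (b x)) {u : ℝ → ℝ → ℝ}
    (hu : ∀ z, IsGlobalSol F (u z)) (huz : ∀ z, u z z = b z) (hB : ∀ z x, z ≤ x → u z x ≤ B x)
    (x : ℝ) : Tendsto (fun z => u z x) atBot (nhds (⨆ n : ℕ, u (x - n) x)) := by
  have hanti : ∀ z z', z ≤ z' → u z' x ≤ u z x := fun z z' h =>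
    (hu z').le_of_le hF (hu z) (z := z')
      ((huz z').le.trans ((hu z).ge_of_barrier hb hlt (huz z).ge h)) x
  have hbdd : BddAbove (range fun n : ℕ => u (x - n) x) := by
    refine ⟨B x, ?_⟩
    rintro _ ⟨n, rfl⟩
    exact hB _ _ (by simp)
  refine tendsto_order.2 ⟨fun y hy => ?_, fun y hy => Eventually.of_forall fun z => ?_⟩
  · obtain ⟨n, hn⟩ := exists_lt_of_lt_ciSup hy
    filter_upwards [eventually_le_atBot (x - n : ℝ)] with z hz
    exact hn.trans_le (hanti _ _ hz)
  · obtain ⟨n, hn⟩ := exists_nat_ge (x - z)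
    exact ((hanti (x - n) z (by linarith)).trans (le_ciSup hbdd n)).trans_lt hy

/-- A solution leading from below `B` to above `B` first hits `B` at some point. -/
theorem exists_first_hit {u B : ℝ → ℝ} (hu : Continuous u) (hB : Continuous B) {z x : ℝ}
    (hzx : z ≤ x) (hz : u z < B z) (hx : B x ≤ u x) :
    ∃ y, z < y ∧ u y = B y ∧ ∀ s ∈ Icc z y, u s ≤ B s := by
  have hne : (Icc z x ∩ {s | u s = B s}).Nonempty := by
    obtain ⟨y, hy, hyeq⟩ := isPreconnected_Icc.intermediate_value₂ (left_mem_Icc.2 hzx)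
      (right_mem_Icc.2 hzx) hu.continuousOn hB.continuousOn hz.le hx
    exact ⟨y, hy, hyeq⟩
  obtain ⟨y, ⟨hy, hyeq⟩, hleast⟩ :=
    (isCompact_Icc.inter_right (isClosed_eq hu hB)).exists_isLeast hne
  refine ⟨y, lt_of_le_of_ne hy.1 (by rintro rfl; exact hz.ne hyeq), hyeq, fun s hs => ?_⟩
  by_contra! hlt
  obtain ⟨w, hw, hweq⟩ := isPreconnected_Icc.intermediate_value₂ (left_mem_Icc.2 hs.1)
      (right_mem_Icc.2 hs.1) hu.continuousOn hB.continuousOn hz.le hlt.le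
  have hyw := hleast ⟨⟨hw.1, hw.2.trans (hs.2.trans hy.2)⟩, hweq⟩
  have : s = y := le_antisymm hs.2 (hyw.trans hw.2)
  rw [this, hyeq] at hlt
  exact hlt.false

theorem measurable_intervalIntegral_param {Ω : Type*} [MeasurableSpace Ω] {k : Ω × ℝ → ℝ}
    (hk : Measurable k) : Measurable fun q : Ω × ℝ => ∫ s in (0 : ℝ)..q.2, k (q.1, s) := by
  have key : ∀ l r : Ω × ℝ → ℝ, Measurable l → Measurable r →
      Measurable fun q => ∫ s in Ioc (l q) (r q), k (q.1, s) := by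
    intro l r hl hr
    have hset : MeasurableSet {p : (Ω × ℝ) × ℝ | p.2 ∈ Ioc (l p.1) (r p.1)} :=
      (measurableSet_lt (hl.comp measurable_fst) measurable_snd).inter
        (measurableSet_le measurable_snd (hr.comp measurable_fst))
    have hm : Measurable fun p : (Ω × ℝ) × ℝ => k (p.1.1, p.2) :=
      hk.comp ((measurable_fst.comp measurable_fst).prodMk measurable_snd)
    simp_rw [← integral_indicator measurableSet_Ioc]
    exact ((hm.indicator hset).stronglyMeasurable.integral_prod_right' (ν := volume)).measurable
  exact (key _ _ measurable_const measurable_snd).sub (key _ _ measurable_snd measurable_const)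

theorem measurable_picardIter {Ω : Type*} [MeasurableSpace Ω] {F : Ω → ℝ → ℝ → ℝ}
    (hF : Measurable fun q : Ω × ℝ × ℝ => F q.1 q.2.1 q.2.2) {c : Ω → ℝ} (hc : Measurable c)
    (n : ℕ) : Measurable fun q : Ω × ℝ => picardIter (F q.1) (c q.1) n q.2 := by
  induction n with
  | zero => exact hc.comp measurable_fst
  | succ n ih =>
    exact (hc.comp measurable_fst).add (measurable_intervalIntegral_param
      (hF.comp (measurable_fst.prodMk (measurable_snd.prodMk ih))))

theorem measurable_picardLimit {Ω : Type*} [MeasurableSpace Ω] {F : Ω → ℝ → ℝ → ℝ}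
    (hF : Measurable fun q : Ω × ℝ × ℝ => F q.1 q.2.1 q.2.2) {c : Ω → ℝ} (hc : Measurable c) :
    Measurable fun q : Ω × ℝ => picardLimit (F q.1) (c q.1) q.2 :=
  Measurable.limsup fun n => measurable_picardIter hF hc n

/-- An ergodic environment with a stationary first-order operator `a(x) f' + H(f, x)` whose
coefficients are regular enough for the Cauchy–Lipschitz theorem. -/
structure StationaryEnv {Ω : Type} [MeasurableSpace Ω] (P : Measure Ω) (τ : ℝ → Ω → Ω)
    (a : ℝ → Ω → ℝ) (H : ℝ → ℝ → Ω → ℝ) : Prop where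
  prob : IsProbabilityMeasure P
  meas_tau : Measurable fun q : ℝ × Ω => τ q.1 q.2
  mp_tau : ∀ x, MeasurePreserving (τ x) P P
  tau_add : ∀ x y ω, τ (x + y) ω = τ x (τ y ω)
  ergodic : ∀ A : Set Ω, MeasurableSet A → (∀ x, τ x ⁻¹' A = A) → P A = 0 ∨ P A = 1
  meas_a : Measurable fun q : ℝ × Ω => a q.1 q.2
  a_pos : ∀ x ω, 0 < a x ω
  a_stat : ∀ x ω, a x ω = a 0 (τ x ω)
  a_cont : ∀ ω, Continuous fun x => a x ω
  meas_H : Measurable fun q : ℝ × ℝ × Ω => H q.1 q.2.1 q.2.2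
  H_stat : ∀ p x ω, H p x ω = H p 0 (τ x ω)
  H_cont : ∀ ω, Continuous fun q : ℝ × ℝ => H q.1 q.2 ω
  H_lip : ∀ R > (0:ℝ), ∃ K > (0:ℝ), ∀ p q x ω, |p| ≤ R → |q| ≤ R →
      |H p x ω - H q x ω| ≤ K * |p - q|

theorem StationaryEnv.exists_invariant_of_ae {Ω : Type} [MeasurableSpace Ω] {P : Measure Ω}
    {τ : ℝ → Ω → Ω} {a : ℝ → Ω → ℝ} {H : ℝ → ℝ → Ω → ℝ} (S : StationaryEnv P τ a H)
    {Q : Ω → Prop} (hQ : ∀ᵐ ω ∂P, Q ω) (hinv : ∀ x ω, Q (τ x ω) → Q ω) :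
    ∃ G, MeasurableSet G ∧ (∀ x, τ x ⁻¹' G = G) ∧ P G = 1 ∧ ∀ ω ∈ G, Q ω := by
  have := S.prob
  obtain ⟨N, hNQ, hN, hN0⟩ := exists_measurable_superset_of_null (ae_iff.1 hQ)
  have hT : Measurable fun q : Ω × ℝ => τ q.2 q.1 := S.meas_tau.comp measurable_swap
  have hTN : MeasurableSet ((fun q : Ω × ℝ => τ q.2 q.1) ⁻¹' N) := hT hN
  let v : Ω → ENNReal := fun ω => volume {x | τ x ω ∈ N}
  have hv : Measurable v := measurable_measure_prodMk_left hTN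
  refine ⟨{ω | v ω = 0}, hv (measurableSet_singleton 0), fun x => ?_, ?_, fun ω hω => ?_⟩
  · ext ω
    have : {y | τ y (τ x ω) ∈ N} = (fun y => y + x) ⁻¹' {y | τ y ω ∈ N} := by
      ext y; simp [S.tau_add]
    change volume {y | τ y (τ x ω) ∈ N} = 0 ↔ volume {y | τ y ω ∈ N} = 0
    rw [this, measure_preimage_add_right]
  · have h0 : (P.prod volume) ((fun q : Ω × ℝ => τ q.2 q.1) ⁻¹' N) = 0 := by
      rw [Measure.prod_apply_symm hTN, lintegral_eq_zero_iff (measurable_measure_prodMk_right hTN)]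
      exact Eventually.of_forall fun x =>
        ((S.mp_tau x).measure_preimage hN.nullMeasurableSet).trans hN0
    have := (Measure.measure_prod_null hTN).1 h0
    exact (mem_ae_iff_prob_eq_one (hv (measurableSet_singleton 0))).1 this
  · have : ∃ x, τ x ω ∉ N := by
      by_contra! h
      have : v ω = ⊤ := by simp [v, h]
      simp_all
    obtain ⟨x, hx⟩ := this
    exact hinv x ω (by by_contra h; exact hx (hNQ h))

theorem stationary_shift {Ω : Type} {τ : ℝ → Ω → Ω} (hadd : ∀ x y ω, τ (x + y) ω = τ x (τ y ω))
    {f : ℝ → Ω → ℝ} (hf : ∀ x ω, f x ω = f 0 (τ x ω)) (x y : ℝ) (ω : Ω) :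
    f x (τ y ω) = f (x + y) ω := by
  rw [hf x, hf (x + y), hadd]

/-- The right-hand side of `f' = (lam - H(f, x)) / a(x)`, with `f` clamped between `f₁`
and `f₂`. -/
noncomputable def stripField {Ω : Type} (a : ℝ → Ω → ℝ) (H : ℝ → ℝ → Ω → ℝ) (lam : ℝ)
    (f₁ f₂ : ℝ → Ω → ℝ) (ω : Ω) (x p : ℝ) : ℝ :=
  (lam - H (max (f₁ x ω) (min p (f₂ x ω))) x ω) / a x ω

theorem stripField_of_mem {Ω : Type} {a : ℝ → Ω → ℝ} {H : ℝ → ℝ → Ω → ℝ} {lam : ℝ}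
    {f₁ f₂ : ℝ → Ω → ℝ} {ω : Ω} {x p : ℝ} (h₁ : f₁ x ω ≤ p) (h₂ : p ≤ f₂ x ω) :
    stripField a H lam f₁ f₂ ω x p = (lam - H p x ω) / a x ω := by
  rw [stripField, min_eq_left h₂, max_eq_right h₁]

section

variable {Ω : Type} [MeasurableSpace Ω] {P : Measure Ω} {τ : ℝ → Ω → Ω}
  {a : ℝ → Ω → ℝ} {H : ℝ → ℝ → Ω → ℝ}

theorem StationaryEnv.isTameField_stripField (S : StationaryEnv P τ a H) (lam : ℝ)
    {f₁ f₂ : ℝ → Ω → ℝ} {ω : Ω} (hc₁ : Continuous fun x => f₁ x ω)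
    (hc₂ : Continuous fun x => f₂ x ω) {R : ℝ} (hb₁ : ∀ x, |f₁ x ω| ≤ R)
    (hb₂ : ∀ x, |f₂ x ω| ≤ R) : IsTameField (stripField a H lam f₁ f₂ ω) := by
  have hclamp : ∀ x p, |max (f₁ x ω) (min p (f₂ x ω))| ≤ R := fun x p => by
    have h₁ := abs_le.1 (hb₁ x)
    have h₂ := abs_le.1 (hb₂ x)
    exact abs_le.2 ⟨h₁.1.trans (le_max_left _ _), max_le h₁.2 ((min_le_right _ _).trans h₂.2)⟩
  have hk : Continuous fun q : ℝ × ℝ => (lam - H q.2 q.1 ω) / a q.1 ω :=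
    (continuous_const.sub ((S.H_cont ω).comp continuous_swap)).div
      ((S.a_cont ω).comp continuous_fst) fun q => (S.a_pos _ _).ne'
  refine ⟨?_, fun T => ?_, fun T => ?_⟩
  · have hcl : Continuous fun q : ℝ × ℝ => (q.1, max (f₁ q.1 ω) (min q.2 (f₂ q.1 ω))) :=
      continuous_fst.prodMk ((hc₁.comp continuous_fst).max
        (continuous_snd.min (hc₂.comp continuous_fst)))
    exact hk.comp hcl
  · have hR : 0 ≤ R := (abs_nonneg _).trans (hb₁ 0)
    obtain ⟨K, hK, hHK⟩ := S.H_lip (R + 1) (by linarith)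
    have hinv : Continuous fun x => (a x ω)⁻¹ := (S.a_cont ω).inv₀ fun x => (S.a_pos _ _).ne'
    obtain ⟨A, hA⟩ := ((isCompact_Icc (a := -T) (b := T)).image hinv).bddAbove
    refine ⟨(K * A).toNNReal, fun x hx => LipschitzWith.of_dist_le_mul fun p q => ?_⟩
    have hAx : (a x ω)⁻¹ ≤ A := hA ⟨x, abs_le.1 hx, rfl⟩
    have hax : 0 < (a x ω)⁻¹ := inv_pos.2 (S.a_pos _ _)
    rw [Real.coe_toNNReal _ (mul_nonneg hK.le (hax.le.trans hAx)), Real.dist_eq, Real.dist_eq,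
      stripField, stripField, ← sub_div, div_eq_mul_inv, abs_mul, abs_of_pos hax,
      sub_sub_sub_cancel_left, abs_sub_comm]
    have hcl : |max (f₁ x ω) (min p (f₂ x ω)) - max (f₁ x ω) (min q (f₂ x ω))| ≤ |p - q| := by
      refine (abs_max_sub_max_le_max _ _ _ _).trans ?_
      simpa using abs_min_sub_min_le_max p (f₂ x ω) q (f₂ x ω)
    calc _ ≤ K * |p - q| * A := by
          gcongr
          refine (hHK _ _ x ω ((hclamp x p).trans (by linarith))
            ((hclamp x q).trans (by linarith))).trans ?_
          gcongr
      _ = K * A * |p - q| := by ring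
  · obtain ⟨B, hB⟩ := (((isCompact_Icc (a := -T) (b := T)).prod
      (isCompact_Icc (a := -R) (b := R))).image hk.abs).bddAbove
    refine ⟨B.toNNReal, fun x hx p => le_trans ?_ (Real.le_coe_toNNReal B)⟩
    exact hB ⟨(x, max (f₁ x ω) (min p (f₂ x ω))), ⟨abs_le.1 hx, abs_le.1 (hclamp x p)⟩, rfl⟩

theorem StationaryEnv.measurable_stripField (S : StationaryEnv P τ a H) (lam : ℝ)
    {f₁ f₂ : ℝ → Ω → ℝ} (hm₁ : Measurable fun q : ℝ × Ω => f₁ q.1 q.2)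
    (hm₂ : Measurable fun q : ℝ × Ω => f₂ q.1 q.2) :
    Measurable fun q : Ω × ℝ × ℝ => stripField a H lam f₁ f₂ q.1 q.2.1 q.2.2 := by
  have hxω : Measurable fun q : Ω × ℝ × ℝ => (q.2.1, q.1) := by fun_prop
  have hp : Measurable fun q : Ω × ℝ × ℝ => q.2.2 := by fun_prop
  have hcl := (hm₁.comp hxω).max (hp.min (hm₂.comp hxω))
  exact (measurable_const.sub (S.meas_H.comp (hcl.prodMk hxω))).div (S.meas_a.comp hxω)

theorem StationaryEnv.stripField_shift (S : StationaryEnv P τ a H) (lam : ℝ)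
    {f₁ f₂ : ℝ → Ω → ℝ} (hs₁ : ∀ x ω, f₁ x ω = f₁ 0 (τ x ω))
    (hs₂ : ∀ x ω, f₂ x ω = f₂ 0 (τ x ω)) (z : ℝ) (ω : Ω) (x p : ℝ) :
    stripField a H lam f₁ f₂ (τ z ω) x p = stripField a H lam f₁ f₂ ω (x + z) p := by
  simp only [stripField, stationary_shift S.tau_add hs₁, stationary_shift S.tau_add hs₂,
    stationary_shift S.tau_add S.a_stat, fun q => stationary_shift S.tau_add (S.H_stat q)]

/-- Two bounded stationary solutions for the value `lam`, strictly ordered on an invariant event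
`G` of full probability. -/
structure OrderedPair (P : Measure Ω) (τ : ℝ → Ω → Ω) (a : ℝ → Ω → ℝ) (H : ℝ → ℝ → Ω → ℝ)
    (lam R : ℝ) (G : Set Ω) (f₁ f₂ : ℝ → Ω → ℝ) : Prop where
  meas₁ : Measurable fun q : ℝ × Ω => f₁ q.1 q.2
  meas₂ : Measurable fun q : ℝ × Ω => f₂ q.1 q.2
  stat₁ : ∀ x ω, f₁ x ω = f₁ 0 (τ x ω)
  stat₂ : ∀ x ω, f₂ x ω = f₂ 0 (τ x ω)
  contDiff₁ : ∀ ω, ContDiff ℝ 1 fun x => f₁ x ω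
  contDiff₂ : ∀ ω, ContDiff ℝ 1 fun x => f₂ x ω
  measG : MeasurableSet G
  invG : ∀ x, τ x ⁻¹' G = G
  probG : P G = 1
  bound₁ : ∀ ω ∈ G, ∀ x, |f₁ x ω| ≤ R
  bound₂ : ∀ ω ∈ G, ∀ x, |f₂ x ω| ≤ R
  ode₁ : ∀ ω ∈ G, ∀ x, a x ω * deriv (fun y => f₁ y ω) x + H (f₁ x ω) x ω = lam
  ode₂ : ∀ ω ∈ G, ∀ x, a x ω * deriv (fun y => f₂ y ω) x + H (f₂ x ω) x ω = lam
  lt : ∀ ω ∈ G, ∀ x, f₁ x ω < f₂ x ω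

/-- The solution of the clamped equation started on the graph of `f₁` at `z`. -/
noncomputable def stripSol (τ : ℝ → Ω → Ω) (a : ℝ → Ω → ℝ) (H : ℝ → ℝ → Ω → ℝ) (lam : ℝ)
    (f₁ f₂ : ℝ → Ω → ℝ) (z x : ℝ) (ω : Ω) : ℝ :=
  picardLimit (stripField a H lam f₁ f₂ (τ z ω)) (f₁ 0 (τ z ω)) (x - z)

theorem StationaryEnv.stripSol_shift (S : StationaryEnv P τ a H) (lam : ℝ)
    (f₁ f₂ : ℝ → Ω → ℝ) (z x y : ℝ) (ω : Ω) :
    stripSol τ a H lam f₁ f₂ z x (τ y ω) = stripSol τ a H lam f₁ f₂ (z + y) (x + y) ω := by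
  simp only [stripSol, S.tau_add, add_sub_add_right_eq_sub]

namespace OrderedPair

variable {lam R : ℝ} {G : Set Ω} {f₁ f₂ : ℝ → Ω → ℝ}

theorem mem_shift (O : OrderedPair P τ a H lam R G f₁ f₂) (x : ℝ) (ω : Ω) :
    τ x ω ∈ G ↔ ω ∈ G := by
  rw [← mem_preimage, O.invG]

theorem isTameField (O : OrderedPair P τ a H lam R G f₁ f₂) (S : StationaryEnv P τ a H) (μ : ℝ)
    {ω : Ω} (hω : ω ∈ G) : IsTameField (stripField a H μ f₁ f₂ ω) :=
  S.isTameField_stripField μ (O.contDiff₁ ω).continuous (O.contDiff₂ ω).continuous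
    (O.bound₁ ω hω) (O.bound₂ ω hω)

theorem hasDerivAt₁ (O : OrderedPair P τ a H lam R G f₁ f₂) (ω : Ω) (x : ℝ) :
    HasDerivAt (fun y => f₁ y ω) (deriv (fun y => f₁ y ω) x) x :=
  ((O.contDiff₁ ω).differentiable one_ne_zero x).hasDerivAt

theorem hasDerivAt₂ (O : OrderedPair P τ a H lam R G f₁ f₂) (ω : Ω) (x : ℝ) :
    HasDerivAt (fun y => f₂ y ω) (deriv (fun y => f₂ y ω) x) x :=
  ((O.contDiff₂ ω).differentiable one_ne_zero x).hasDerivAt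

theorem deriv₁_lt (O : OrderedPair P τ a H lam R G f₁ f₂) (S : StationaryEnv P τ a H) {μ : ℝ}
    (hμ : lam < μ) {ω : Ω} (hω : ω ∈ G) (x : ℝ) :
    deriv (fun y => f₁ y ω) x < stripField a H μ f₁ f₂ ω x (f₁ x ω) := by
  rw [stripField_of_mem le_rfl (O.lt ω hω x).le, lt_div_iff₀ (S.a_pos _ _)]
  linarith [O.ode₁ ω hω x]

theorem deriv₂_lt (O : OrderedPair P τ a H lam R G f₁ f₂) (S : StationaryEnv P τ a H) {μ : ℝ}
    (hμ : lam < μ) {ω : Ω} (hω : ω ∈ G) (x : ℝ) :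
    deriv (fun y => f₂ y ω) x < stripField a H μ f₁ f₂ ω x (f₂ x ω) := by
  rw [stripField_of_mem (O.lt ω hω x).le le_rfl, lt_div_iff₀ (S.a_pos _ _)]
  linarith [O.ode₂ ω hω x]

theorem isGlobalSol_stripSol (O : OrderedPair P τ a H lam R G f₁ f₂) (S : StationaryEnv P τ a H)
    (μ : ℝ) {ω : Ω} (hω : ω ∈ G) (z : ℝ) :
    IsGlobalSol (stripField a H μ f₁ f₂ ω) fun x => stripSol τ a H μ f₁ f₂ z x ω := by
  intro x
  have h := (O.isTameField S μ ((O.mem_shift z ω).2 hω)).isGlobalSol_picardLimit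
    (f₁ 0 (τ z ω)) (x - z)
  rw [S.stripField_shift μ O.stat₁ O.stat₂, sub_add_cancel] at h
  exact h.comp_sub_const x z

theorem stripSol_self (O : OrderedPair P τ a H lam R G f₁ f₂) (S : StationaryEnv P τ a H)
    (μ : ℝ) {ω : Ω} (hω : ω ∈ G) (z : ℝ) : stripSol τ a H μ f₁ f₂ z z ω = f₁ z ω := by
  rw [stripSol, sub_self, (O.isTameField S μ ((O.mem_shift z ω).2 hω)).picardLimit_zero, ← O.stat₁]

theorem measurable_stripSol (O : OrderedPair P τ a H lam R G f₁ f₂) (S : StationaryEnv P τ a H)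
    (μ z x : ℝ) : Measurable (stripSol τ a H μ f₁ f₂ z x) := by
  have hτ : Measurable (τ z) := S.meas_tau.comp measurable_prodMk_left
  have h₀ : Measurable (f₁ 0) := O.meas₁.comp measurable_prodMk_left
  have h : Measurable fun q : Ω × ℝ =>
      picardLimit (stripField a H μ f₁ f₂ q.1) (f₁ 0 q.1) q.2 :=
    measurable_picardLimit (F := stripField a H μ f₁ f₂)
      (S.measurable_stripField μ O.meas₁ O.meas₂) h₀
  have hpair : Measurable fun ω => (τ z ω, x - z) := hτ.prodMk measurable_const
  have hcomp := h.comp hpair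
  simp only [Function.comp_def] at hcomp
  exact hcomp

theorem le_stripSol (O : OrderedPair P τ a H lam R G f₁ f₂) (S : StationaryEnv P τ a H) {μ : ℝ}
    (hμ : lam < μ) {ω : Ω} (hω : ω ∈ G) {z x : ℝ} (hzx : z ≤ x) :
    f₁ x ω ≤ stripSol τ a H μ f₁ f₂ z x ω :=
  (O.isGlobalSol_stripSol S μ hω z).ge_of_barrier (O.hasDerivAt₁ ω) (O.deriv₁_lt S hμ hω)
    (O.stripSol_self S μ hω z).ge hzx

theorem stripSol_anti (O : OrderedPair P τ a H lam R G f₁ f₂) (S : StationaryEnv P τ a H) {μ : ℝ}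
    (hμ : lam < μ) {ω : Ω} (hω : ω ∈ G) {z z' : ℝ} (hz : z ≤ z') (x : ℝ) :
    stripSol τ a H μ f₁ f₂ z' x ω ≤ stripSol τ a H μ f₁ f₂ z x ω :=
  (O.isGlobalSol_stripSol S μ hω z').le_of_le (O.isTameField S μ hω)
    (O.isGlobalSol_stripSol S μ hω z) (z := z')
    ((O.stripSol_self S μ hω z').le.trans (O.le_stripSol S hμ hω hz)) x

/-- The event that some solution started on the graph of `f₁` reaches the graph of `f₂`. -/
def crossing (τ : ℝ → Ω → Ω) (a : ℝ → Ω → ℝ) (H : ℝ → ℝ → Ω → ℝ) (μ : ℝ) (G : Set Ω)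
    (f₁ f₂ : ℝ → Ω → ℝ) : Set Ω :=
  {ω | ω ∈ G ∧ ∃ z x, z ≤ x ∧ f₂ x ω ≤ stripSol τ a H μ f₁ f₂ z x ω}

theorem crossing_inv (O : OrderedPair P τ a H lam R G f₁ f₂) (S : StationaryEnv P τ a H) (μ y : ℝ) :
    τ y ⁻¹' crossing τ a H μ G f₁ f₂ = crossing τ a H μ G f₁ f₂ := by
  ext ω
  simp only [crossing, mem_preimage, mem_ofPred_eq, O.mem_shift, S.stripSol_shift,
    stationary_shift S.tau_add O.stat₂]
  refine and_congr_right fun _ => ⟨?_, ?_⟩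
  · rintro ⟨z, x, hzx, h⟩
    exact ⟨z + y, x + y, by linarith, h⟩
  · rintro ⟨z, x, hzx, h⟩
    exact ⟨z - y, x - y, by linarith, by simpa using h⟩

theorem measurableSet_crossing (O : OrderedPair P τ a H lam R G f₁ f₂)
    (S : StationaryEnv P τ a H) {μ : ℝ} (hμ : lam < μ) :
    MeasurableSet (crossing τ a H μ G f₁ f₂) := by
  have : crossing τ a H μ G f₁ f₂
      = G ∩ ⋃ (m : ℤ) (n : ℤ) (_ : m ≤ n), {ω | f₂ n ω ≤ stripSol τ a H μ f₁ f₂ m n ω} := by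
    ext ω
    simp only [crossing, mem_ofPred_eq, mem_inter_iff, mem_iUnion, exists_prop]
    refine and_congr_right fun hω => ⟨?_, ?_⟩
    · rintro ⟨z, x, hzx, h⟩
      refine ⟨⌊z⌋, ⌈x⌉, ?_, ?_⟩
      · exact_mod_cast (Int.floor_le z).trans (hzx.trans (Int.le_ceil x))
      · exact (O.isGlobalSol_stripSol S μ hω ⌊z⌋).ge_of_barrier (O.hasDerivAt₂ ω)
          (O.deriv₂_lt S hμ hω) (h.trans (O.stripSol_anti S hμ hω (Int.floor_le z) x))
          (Int.le_ceil x)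
    · rintro ⟨m, n, hmn, h⟩
      exact ⟨m, n, by exact_mod_cast hmn, h⟩
  rw [this]
  exact O.measG.inter (.iUnion fun m => .iUnion fun n => .iUnion fun _ =>
    measurableSet_le (O.meas₂.comp measurable_prodMk_left) (O.measurable_stripSol S μ m n))

theorem exists_bridge (O : OrderedPair P τ a H lam R G f₁ f₂) (S : StationaryEnv P τ a H) {μ : ℝ}
    (hμ : lam < μ) {ω : Ω} (hω : ω ∈ crossing τ a H μ G f₁ f₂) :
    ∃ z₁ z₂ : ℝ, z₁ < z₂ ∧ ∃ g g' : ℝ → ℝ,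
      (∀ x ∈ Icc z₁ z₂, HasDerivWithinAt g (g' x) (Icc z₁ z₂) x) ∧
      ContinuousOn g' (Icc z₁ z₂) ∧
      (∀ x ∈ Icc z₁ z₂, a x ω * g' x + H (g x) x ω = μ) ∧
      g z₁ = f₁ z₁ ω ∧ g z₂ = f₂ z₂ ω := by
  obtain ⟨hG, z, x, hzx, h⟩ := hω
  have hu := O.isGlobalSol_stripSol S μ hG z
  obtain ⟨y, hzy, hy, hle⟩ := exists_first_hit hu.continuous (O.contDiff₂ ω).continuous hzx
    (by simpa only [O.stripSol_self S μ hG z] using O.lt ω hG z) h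
  refine ⟨z, y, hzy, _, _, fun s _ => (hu s).hasDerivWithinAt,
    ((O.isTameField S μ hG).continuous_comp hu.continuous).continuousOn, fun s hs => ?_,
    O.stripSol_self S μ hG z, hy⟩
  rw [stripField_of_mem (O.le_stripSol S hμ hG hs.1) (hle s hs),
    mul_div_cancel₀ _ (S.a_pos _ _).ne', sub_add_cancel]

open Classical in
/-- The limit of the solutions started on the graph of `f₁` at times going to `-∞`, extended by
`f₁` outside of the event `D`. -/
noncomputable def backwardLimit (τ : ℝ → Ω → Ω) (a : ℝ → Ω → ℝ) (H : ℝ → ℝ → Ω → ℝ) (μ : ℝ)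
    (D : Set Ω) (f₁ f₂ : ℝ → Ω → ℝ) (x : ℝ) (ω : Ω) : ℝ :=
  if ω ∈ D then ⨆ n : ℕ, stripSol τ a H μ f₁ f₂ (x - n) x ω else f₁ x ω

theorem tendsto_stripSol (O : OrderedPair P τ a H lam R G f₁ f₂) (S : StationaryEnv P τ a H)
    {μ : ℝ} (hμ : lam < μ) {ω : Ω} (hω : ω ∈ G \ crossing τ a H μ G f₁ f₂) (x : ℝ) :
    Tendsto (fun z => stripSol τ a H μ f₁ f₂ z x ω) atBot
      (nhds (backwardLimit τ a H μ (G \ crossing τ a H μ G f₁ f₂) f₁ f₂ x ω)) := by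
  rw [backwardLimit, if_pos hω]
  refine tendsto_backward_iSup (O.isTameField S μ hω.1) (O.hasDerivAt₁ ω) (O.deriv₁_lt S hμ hω.1)
    (O.isGlobalSol_stripSol S μ hω.1) (O.stripSol_self S μ hω.1) (B := fun x => f₂ x ω) ?_ x
  intro z x hzx
  by_contra! h
  exact hω.2 ⟨hω.1, z, x, hzx, h.le⟩

theorem statSol_backwardLimit (O : OrderedPair P τ a H lam R G f₁ f₂) (S : StationaryEnv P τ a H)
    {μ : ℝ} (hμ : lam < μ) (h0 : P (crossing τ a H μ G f₁ f₂) = 0) :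
    ∃ f, StatSol P τ a H μ f ∧ ∀ᵐ ω ∂P, f₁ 0 ω < f 0 ω ∧ f 0 ω < f₂ 0 ω := by
  have := S.prob
  set C := crossing τ a H μ G f₁ f₂ with hC
  have hCm : MeasurableSet C := O.measurableSet_crossing S hμ
  have hD : ∀ᵐ ω ∂P, ω ∈ G \ C := by
    filter_upwards [(mem_ae_iff_prob_eq_one O.measG).2 O.probG, measure_eq_zero_iff_ae_notMem.1 h0]
      with ω h₁ h₂ using ⟨h₁, h₂⟩
  set f := backwardLimit τ a H μ (G \ C) f₁ f₂ with hf
  have hmemD : ∀ x ω, τ x ω ∈ G \ C ↔ ω ∈ G \ C := fun x ω => by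
    rw [← mem_preimage, preimage_sdiff, O.invG, O.crossing_inv S]
  have hstat : ∀ x ω, f x ω = f 0 (τ x ω) := fun x ω => by
    by_cases hω : ω ∈ G \ C
    · rw [hf, backwardLimit, backwardLimit, if_pos hω, if_pos ((hmemD x ω).2 hω)]
      simp [S.stripSol_shift, sub_eq_add_neg, add_comm]
    · rw [hf, backwardLimit, backwardLimit, if_neg hω, if_neg (mt (hmemD x ω).1 hω), O.stat₁]
  have hsol : ∀ ω ∈ G \ C, IsGlobalSol (stripField a H μ f₁ f₂ ω) fun x => f x ω := fun ω hω =>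
    isGlobalSol_of_tendsto (O.isTameField S μ hω.1) (O.isGlobalSol_stripSol S μ hω.1)
      (O.tendsto_stripSol S hμ hω)
  have hlow : ∀ ω ∈ G \ C, ∀ x, f₁ x ω < f x ω := fun ω hω x => by
    have hle : ∀ x, f₁ x ω ≤ f x ω := fun x => by
      refine ge_of_tendsto (O.tendsto_stripSol S hμ hω x) ?_
      filter_upwards [eventually_le_atBot x] with z hz using O.le_stripSol S hμ hω.1 hz
    exact (hle x).lt_of_ne ((hsol ω hω).barrier_ne (O.hasDerivAt₁ ω) (O.deriv₁_lt S hμ hω.1)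
      (Or.inl hle) x)
  have hupp : ∀ ω ∈ G \ C, ∀ x, f x ω < f₂ x ω := fun ω hω x => by
    have hle : ∀ x, f x ω ≤ f₂ x ω := fun x => by
      refine le_of_tendsto (O.tendsto_stripSol S hμ hω x) ?_
      filter_upwards [eventually_le_atBot x] with z hz
      by_contra! h
      exact hω.2 ⟨hω.1, z, x, hz, h.le⟩
    exact (hle x).lt_of_ne ((hsol ω hω).barrier_ne (O.hasDerivAt₂ ω) (O.deriv₂_lt S hμ hω.1)
      (Or.inr hle) x).symm
  have hmeas0 : Measurable (f 0) :=
    Measurable.ite (O.measG.diff hCm) (.iSup fun n => O.measurable_stripSol S μ _ _)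
      (O.meas₁.comp measurable_prodMk_left)
  refine ⟨f, ⟨?_, hstat, fun ω => ?_, ?_⟩, ?_⟩
  · simp_rw [fun q : ℝ × Ω => hstat q.1 q.2]
    exact hmeas0.comp S.meas_tau
  · by_cases hω : ω ∈ G \ C
    · have hs := hsol ω hω
      refine contDiff_one_iff_deriv.2 ⟨fun x => (hs x).differentiableAt, ?_⟩
      rw [show deriv (fun x => f x ω) = _ from funext fun x => (hs x).deriv]
      exact (O.isTameField S μ hω.1).continuous_comp hs.continuous
    · have : (fun x => f x ω) = fun x => f₁ x ω := funext fun x => if_neg hω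
      rw [this]
      exact O.contDiff₁ ω
  · filter_upwards [hD] with ω hω
    refine ⟨⟨R, fun x => abs_le.2 ⟨?_, ?_⟩⟩, fun x => ?_⟩
    · exact (abs_le.1 (O.bound₁ ω hω.1 x)).1.trans (hlow ω hω x).le
    · exact (hupp ω hω x).le.trans (abs_le.1 (O.bound₂ ω hω.1 x)).2
    · rw [(hsol ω hω x).deriv, stripField_of_mem (hlow ω hω x).le (hupp ω hω x).le,
        mul_div_cancel₀ _ (S.a_pos _ _).ne', sub_add_cancel]
  · filter_upwards [hD] with ω hω using ⟨hlow ω hω 0, hupp ω hω 0⟩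

theorem bridge_or_exists_between (O : OrderedPair P τ a H lam R G f₁ f₂)
    (S : StationaryEnv P τ a H) {μ : ℝ} (hμ : lam < μ) :
    (∀ᵐ ω ∂P, ∃ z₁ z₂ : ℝ, z₁ < z₂ ∧ ∃ g g' : ℝ → ℝ,
      (∀ x ∈ Icc z₁ z₂, HasDerivWithinAt g (g' x) (Icc z₁ z₂) x) ∧
      ContinuousOn g' (Icc z₁ z₂) ∧
      (∀ x ∈ Icc z₁ z₂, a x ω * g' x + H (g x) x ω = μ) ∧
      g z₁ = f₁ z₁ ω ∧ g z₂ = f₂ z₂ ω) ∨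
    ∃ f, StatSol P τ a H μ f ∧ ∀ᵐ ω ∂P, f₁ 0 ω < f 0 ω ∧ f 0 ω < f₂ 0 ω := by
  have := S.prob
  rcases S.ergodic _ (O.measurableSet_crossing S hμ) (O.crossing_inv S μ) with h | h
  · exact Or.inr (O.statSol_backwardLimit S hμ h)
  · left
    filter_upwards [(mem_ae_iff_prob_eq_one (O.measurableSet_crossing S hμ)).2 h] with ω hω
    exact O.exists_bridge S hμ hω

end OrderedPair

end

theorem HJSetting.continuous_a {Ω : Type} [MeasurableSpace Ω] {P : Measure Ω} {τ : ℝ → Ω → Ω}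
    {a : ℝ → Ω → ℝ} {H : ℝ → ℝ → Ω → ℝ} {G_L G_U : ℝ → ℝ} (h : HJSetting P τ a H G_L G_U)
    (ω : Ω) : Continuous fun x => a x ω := by
  obtain ⟨κ, hκ, hlip⟩ := h.a_sqrt_lip
  have hsqrt : Continuous fun x => Real.sqrt (a x ω) := by
    refine (LipschitzWith.of_dist_le_mul (K := κ.toNNReal) fun x y => ?_).continuous
    have := hlip (x - y) (τ y ω)
    rwa [stationary_shift h.tau_add h.a_stat, stationary_shift h.tau_add h.a_stat, zero_add,
      sub_add_cancel, ← Real.dist_eq, ← Real.dist_eq, ← Real.coe_toNNReal κ hκ.le] at this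
  have : (fun x => a x ω) = fun x => Real.sqrt (a x ω) ^ 2 :=
    funext fun x => (Real.sq_sqrt (h.a_pos x ω).le).symm
  rw [this]
  exact hsqrt.pow 2

theorem HJSetting.abs_H_sub_le {Ω : Type} [MeasurableSpace Ω] {P : Measure Ω} {τ : ℝ → Ω → Ω}
    {a : ℝ → Ω → ℝ} {H : ℝ → ℝ → Ω → ℝ} {G_L G_U : ℝ → ℝ} (h : HJSetting P τ a H G_L G_U)
    (R : ℝ) (hR : 0 < R) : ∃ K > (0:ℝ), ∀ p q x ω, |p| ≤ R → |q| ≤ R →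
      |H p x ω - H q x ω| ≤ K * |p - q| := by
  obtain ⟨K, hK, hlip⟩ := h.H_lip R hR
  refine ⟨K, hK, fun p q x ω hp hq => ?_⟩
  rw [h.H_stat p x, h.H_stat q x]
  exact hlip p q _ hp hq

theorem HJSetting.continuous_H {Ω : Type} [MeasurableSpace Ω] {P : Measure Ω} {τ : ℝ → Ω → Ω}
    {a : ℝ → Ω → ℝ} {H : ℝ → ℝ → Ω → ℝ} {G_L G_U : ℝ → ℝ} (h : HJSetting P τ a H G_L G_U)
    (ω : Ω) : Continuous fun q : ℝ × ℝ => H q.1 q.2 ω := by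
  refine continuous_iff_continuousAt.2 fun ⟨p₀, x₀⟩ => ?_
  have hR : 0 < |p₀| + 1 := by positivity
  have hx : Tendsto (fun x => H p₀ x ω) (nhds x₀) (nhds (H p₀ x₀ ω)) := by
    obtain ⟨m, -, -, hm, hmod⟩ := h.H_mod (|p₀| + 1) hR
    refine continuousAt_iff_punctured_nhds.2 (tendsto_iff_dist_tendsto_zero.2 ?_)
    have habs : Tendsto (fun x => |x - x₀|) (nhdsWithin x₀ {x₀}ᶜ) (nhdsWithin 0 (Ioi 0)) := by
      refine tendsto_nhdsWithin_iff.2 ⟨?_, ?_⟩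
      · have : Tendsto (fun x => |x - x₀|) (nhds x₀) (nhds |x₀ - x₀|) :=
          (continuous_id.sub continuous_const).abs.tendsto x₀
        rw [sub_self, abs_zero] at this
        exact this.mono_left nhdsWithin_le_nhds
      · filter_upwards [self_mem_nhdsWithin] with x hx using abs_pos.2 (sub_ne_zero.2 hx)
    refine squeeze_zero (fun _ => dist_nonneg) (fun x => ?_) (hm.comp habs)
    have := hmod p₀ (x - x₀) (τ x₀ ω) (by linarith)
    rwa [stationary_shift h.tau_add (h.H_stat p₀), stationary_shift h.tau_add (h.H_stat p₀),
      zero_add, sub_add_cancel, ← Real.dist_eq] at this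
  obtain ⟨K, -, hlip⟩ := h.abs_H_sub_le (|p₀| + 1) hR
  refine tendsto_iff_dist_tendsto_zero.2 ?_
  have hK : Tendsto (fun q : ℝ × ℝ => K * |q.1 - p₀|) (nhds (p₀, x₀)) (nhds 0) := by
    have : Continuous fun q : ℝ × ℝ => K * |q.1 - p₀| := by fun_prop
    simpa using this.tendsto (p₀, x₀)
  have hsum := hK.add ((tendsto_iff_dist_tendsto_zero.1 hx).comp
    (continuous_snd.tendsto (p₀, x₀)))
  rw [add_zero] at hsum
  refine squeeze_zero' (Eventually.of_forall fun _ => dist_nonneg) ?_ hsum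
  have hev : ∀ᶠ q : ℝ × ℝ in nhds (p₀, x₀), |q.1| < |p₀| + 1 :=
    continuous_fst.abs.continuousAt.eventually (gt_mem_nhds (lt_add_one |p₀|))
  filter_upwards [hev] with q hq
  refine (dist_triangle _ (H p₀ q.2 ω) _).trans (add_le_add ?_ le_rfl)
  exact hlip q.1 p₀ q.2 ω hq.le (by linarith)

theorem HJSetting.stationaryEnv {Ω : Type} [MeasurableSpace Ω] {P : Measure Ω} {τ : ℝ → Ω → Ω}
    {a : ℝ → Ω → ℝ} {H : ℝ → ℝ → Ω → ℝ} {G_L G_U : ℝ → ℝ} (h : HJSetting P τ a H G_L G_U) :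
    StationaryEnv P τ a H where
  prob := h.prob
  meas_tau := h.meas_tau
  mp_tau := h.mp_tau
  tau_add := h.tau_add
  ergodic := h.ergodic
  meas_a := h.meas_a
  a_pos := h.a_pos
  a_stat := h.a_stat
  a_cont := h.continuous_a
  meas_H := h.meas_H
  H_stat := h.H_stat
  H_cont := h.continuous_H
  H_lip := h.abs_H_sub_le

section

variable {Ω : Type} [MeasurableSpace Ω] {P : Measure Ω} {τ : ℝ → Ω → Ω}
  {a : ℝ → Ω → ℝ} {H : ℝ → ℝ → Ω → ℝ}

theorem StationaryEnv.reflect (S : StationaryEnv P τ a H) :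
    StationaryEnv P τ a fun p x ω => -H (-p) x ω where
  prob := S.prob
  meas_tau := S.meas_tau
  mp_tau := S.mp_tau
  tau_add := S.tau_add
  ergodic := S.ergodic
  meas_a := S.meas_a
  a_pos := S.a_pos
  a_stat := S.a_stat
  a_cont := S.a_cont
  meas_H := (S.meas_H.comp (measurable_fst.neg.prodMk measurable_snd)).neg
  H_stat p x ω := by rw [S.H_stat (-p)]
  H_cont ω := ((S.H_cont ω).comp (continuous_fst.neg.prodMk continuous_snd)).neg
  H_lip R hR := by
    obtain ⟨K, hK, hlip⟩ := S.H_lip R hR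
    refine ⟨K, hK, fun p q x ω hp hq => ?_⟩
    have := hlip (-q) (-p) x ω (by rwa [abs_neg]) (by rwa [abs_neg])
    rwa [neg_sub_neg] at this ⊢

theorem StatSol.neg {lam : ℝ} {f : ℝ → Ω → ℝ} (hf : StatSol P τ a H lam f) :
    StatSol P τ a (fun p x ω => -H (-p) x ω) (-lam) fun x ω => -f x ω := by
  refine ⟨hf.1.neg, fun x ω => congrArg _ (hf.2.1 x ω), fun ω => (hf.2.2.1 ω).neg, ?_⟩
  filter_upwards [hf.2.2.2] with ω ⟨⟨M, hM⟩, hode⟩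
  refine ⟨⟨M, fun x => by rw [abs_neg]; exact hM x⟩, fun x => ?_⟩
  rw [deriv.fun_neg, neg_neg, ← hode x]
  ring

theorem StatSol.measurable_apply {lam : ℝ} {f : ℝ → Ω → ℝ} (hf : StatSol P τ a H lam f) (x : ℝ) :
    Measurable (f x) :=
  hf.1.comp measurable_prodMk_left

theorem StationaryEnv.exists_invariant_bound (S : StationaryEnv P τ a H) {lam : ℝ}
    {f : ℝ → Ω → ℝ} (hf : StatSol P τ a H lam f) :
    ∃ (R : ℝ) (G : Set Ω), MeasurableSet G ∧ (∀ x, τ x ⁻¹' G = G) ∧ P G = 1 ∧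
      ∀ ω ∈ G, (∀ x, |f x ω| ≤ R) ∧
        ∀ x, a x ω * deriv (fun y => f y ω) x + H (f x ω) x ω = lam := by
  have hshift := stationary_shift S.tau_add hf.2.1
  obtain ⟨G, hG, hinv, hPG, hGQ⟩ := S.exists_invariant_of_ae hf.2.2.2 fun y ω hQ => by
    obtain ⟨⟨M, hM⟩, hode⟩ := hQ
    refine ⟨⟨M, fun x => ?_⟩, fun x => ?_⟩
    · simpa [hshift] using hM (x - y)
    · have := hode (x - y)
      simp only [hshift] at this
      rwa [deriv_comp_add_const (fun z => f z ω), stationary_shift S.tau_add S.a_stat,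
        stationary_shift S.tau_add (S.H_stat _), sub_add_cancel] at this
  let A : ℕ → Set Ω := fun n => {ω | ∀ x, |f x ω| ≤ n}
  have hA : ∀ n, MeasurableSet (A n) := fun n => by
    have : A n = ⋂ q : ℚ, {ω | |f q ω| ≤ n} := by
      ext ω
      simp only [A, mem_ofPred_eq, mem_iInter]
      refine ⟨fun h q => h q, fun h x => ?_⟩
      have hclosed : IsClosed {x | |f x ω| ≤ n} :=
        isClosed_le (hf.2.2.1 ω).continuous.abs continuous_const
      have : closure (range ((↑) : ℚ → ℝ)) ⊆ {x | |f x ω| ≤ n} :=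
        hclosed.closure_subset_iff.2 (range_subset_iff.2 h)
      rw [Rat.denseRange_cast.closure_range] at this
      exact this (mem_univ x)
    rw [this]
    exact .iInter fun q => measurableSet_le (hf.measurable_apply q).norm measurable_const
  have hAinv : ∀ n x, τ x ⁻¹' A n = A n := fun n y => by
    ext ω
    simp only [A, mem_preimage, mem_ofPred_eq, hshift]
    exact ⟨fun h x => by simpa using h (x - y), fun h x => h _⟩
  have hGA : G ⊆ ⋃ n, G ∩ A n := fun ω hω => by
    obtain ⟨M, hM⟩ := (hGQ ω hω).1
    obtain ⟨n, hn⟩ := exists_nat_ge M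
    exact mem_iUnion.2 ⟨n, hω, fun x => (hM x).trans hn⟩
  obtain ⟨n, hn⟩ : ∃ n, P (G ∩ A n) ≠ 0 := by
    by_contra! h
    have := measure_mono_null hGA (measure_iUnion_null h)
    simp [hPG] at this
  have hGAinv : ∀ x, τ x ⁻¹' (G ∩ A n) = G ∩ A n := fun x => by
    rw [preimage_inter, hinv, hAinv]
  exact ⟨n, G ∩ A n, hG.inter (hA n), hGAinv,
    (S.ergodic _ (hG.inter (hA n)) hGAinv).resolve_left hn,
    fun ω hω => ⟨hω.2, (hGQ ω hω.1).2⟩⟩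

theorem StationaryEnv.integrable_statSol (S : StationaryEnv P τ a H) {lam : ℝ}
    {f : ℝ → Ω → ℝ} (hf : StatSol P τ a H lam f) : Integrable (f 0) P := by
  have := S.prob
  obtain ⟨R, G, hG, -, hPG, hGR⟩ := S.exists_invariant_bound hf
  refine Integrable.of_bound (hf.measurable_apply 0).aestronglyMeasurable R ?_
  filter_upwards [(mem_ae_iff_prob_eq_one hG).2 hPG] with ω hω using (hGR ω hω).1 0

theorem StationaryEnv.exists_orderedPair (S : StationaryEnv P τ a H) {lam : ℝ}
    {f₁ f₂ : ℝ → Ω → ℝ} (hf₁ : StatSol P τ a H lam f₁) (hf₂ : StatSol P τ a H lam f₂)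
    (hlt : ∫ ω, f₁ 0 ω ∂P < ∫ ω, f₂ 0 ω ∂P) :
    ∃ R G, OrderedPair P τ a H lam R G f₁ f₂ := by
  have := S.prob
  obtain ⟨R₁, G₁, hG₁, hinv₁, hP₁, hb₁⟩ := S.exists_invariant_bound hf₁
  obtain ⟨R₂, G₂, hG₂, hinv₂, hP₂, hb₂⟩ := S.exists_invariant_bound hf₂
  set R := max R₁ R₂
  have hR₁ : ∀ ω ∈ G₁, ∀ x, |f₁ x ω| ≤ R := fun ω hω x => ((hb₁ ω hω).1 x).trans (le_max_left _ _)
  have hR₂ : ∀ ω ∈ G₂, ∀ x, |f₂ x ω| ≤ R := fun ω hω x => ((hb₂ ω hω).1 x).trans (le_max_right _ _)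
  have hsol : ∀ {f : ℝ → Ω → ℝ} {ω : Ω}, (ContDiff ℝ 1 fun x => f x ω) → (∀ x, |f x ω| ≤ R) →
      (∀ x, a x ω * deriv (fun y => f y ω) x + H (f x ω) x ω = lam) →
      IsGlobalSol (stripField a H lam (fun _ _ => -R) (fun _ _ => R) ω) fun x => f x ω := by
    intro f ω hf hb hode x
    have hmem := abs_le.1 (hb x)
    rw [stripField_of_mem (f₁ := fun _ _ => -R) (f₂ := fun _ _ => R) hmem.1 hmem.2, ← hode x,
      add_sub_cancel_right, mul_div_cancel_left₀ _ (S.a_pos _ _).ne']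
    exact (hf.differentiable one_ne_zero x).hasDerivAt
  have hlt_all : ∀ ω ∈ G₁ ∩ G₂, ∀ z, f₁ z ω < f₂ z ω → ∀ x, f₁ x ω < f₂ x ω := by
    intro ω hω z hz
    have hR : |R| ≤ R := (abs_of_nonneg ((abs_nonneg _).trans (hR₁ ω hω.1 0))).le
    exact (hsol (hf₁.2.2.1 ω) (hR₁ ω hω.1) (hb₁ ω hω.1).2).lt_of_lt
      (S.isTameField_stripField lam continuous_const continuous_const
        (fun _ => by rwa [abs_neg]) fun _ => hR)
      (hsol (hf₂.2.2.1 ω) (hR₂ ω hω.2) (hb₂ ω hω.2).2) hz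
  set G := (G₁ ∩ G₂) ∩ {ω | f₁ 0 ω < f₂ 0 ω}
  have hG : MeasurableSet G := (hG₁.inter hG₂).inter
    (measurableSet_lt (hf₁.measurable_apply 0) (hf₂.measurable_apply 0))
  have hinv : ∀ x, τ x ⁻¹' G = G := fun x => by
    rw [preimage_inter, preimage_inter, hinv₁, hinv₂]
    ext ω
    refine and_congr_right fun hω => ?_
    simp only [mem_preimage, mem_ofPred_eq, ← hf₁.2.1, ← hf₂.2.1]
    exact ⟨fun h => hlt_all ω hω x h 0, fun h => hlt_all ω hω 0 h x⟩
  refine ⟨R, G, hf₁.1, hf₂.1, hf₁.2.1, hf₂.2.1, hf₁.2.2.1, hf₂.2.2.1, hG, hinv,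
    (S.ergodic G hG hinv).resolve_left fun h0 => hlt.not_ge ?_, fun ω hω => hR₁ ω hω.1.1,
    fun ω hω => hR₂ ω hω.1.2, fun ω hω => (hb₁ ω hω.1.1).2, fun ω hω => (hb₂ ω hω.1.2).2,
    fun ω hω => hlt_all ω hω.1 0 hω.2⟩
  refine integral_mono_ae (S.integrable_statSol hf₂) (S.integrable_statSol hf₁) ?_
  filter_upwards [(mem_ae_iff_prob_eq_one hG₁).2 hP₁, (mem_ae_iff_prob_eq_one hG₂).2 hP₂,
    measure_eq_zero_iff_ae_notMem.1 h0] with ω h₁ h₂ h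
  exact not_lt.1 fun hω => h ⟨⟨h₁, h₂⟩, hω⟩

theorem integral_lt_integral_of_ae_lt [IsProbabilityMeasure P] {f g : Ω → ℝ}
    (hf : Integrable f P) (hg : Integrable g P) (h : ∀ᵐ ω ∂P, f ω < g ω) :
    ∫ ω, f ω ∂P < ∫ ω, g ω ∂P := by
  rw [← sub_pos, ← integral_sub hg hf, integral_pos_iff_support_of_nonneg_ae
    (h.mono fun _ h => sub_nonneg.2 h.le) (hg.sub hf), pos_iff_ne_zero]
  intro h0
  obtain ⟨ω, hω, hω'⟩ := (h.and (measure_eq_zero_iff_ae_notMem.1 h0)).exists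
  exact hω' (ne_of_gt (sub_pos.2 hω))

/-- Without stationary solutions of intermediate mean, almost surely some solution for the value
`μ > lam` leads from the lower to the upper of two stationary solutions for the value `lam`. -/
theorem StationaryEnv.ae_exists_bridge (S : StationaryEnv P τ a H) {lam μ : ℝ} (hμ : lam < μ)
    {f₁ f₂ : ℝ → Ω → ℝ} (hf₁ : StatSol P τ a H lam f₁) (hf₂ : StatSol P τ a H lam f₂)
    (hlt : ∫ ω, f₁ 0 ω ∂P < ∫ ω, f₂ 0 ω ∂P)
    (hgap : ∀ f, StatSol P τ a H μ f →
      ∫ ω, f 0 ω ∂P ∉ Ioo (∫ ω, f₁ 0 ω ∂P) (∫ ω, f₂ 0 ω ∂P)) :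
    ∀ᵐ ω ∂P, ∃ z₁ z₂ : ℝ, z₁ < z₂ ∧ ∃ g g' : ℝ → ℝ,
      (∀ x ∈ Icc z₁ z₂, HasDerivWithinAt g (g' x) (Icc z₁ z₂) x) ∧
      ContinuousOn g' (Icc z₁ z₂) ∧
      (∀ x ∈ Icc z₁ z₂, a x ω * g' x + H (g x) x ω = μ) ∧
      g z₁ = f₁ z₁ ω ∧ g z₂ = f₂ z₂ ω := by
  have := S.prob
  obtain ⟨R, G, O⟩ := S.exists_orderedPair hf₁ hf₂ hlt
  refine (O.bridge_or_exists_between S hμ).resolve_right ?_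
  rintro ⟨f, hf, hbetween⟩
  have hint := S.integrable_statSol hf
  exact hgap f hf
    ⟨integral_lt_integral_of_ae_lt (S.integrable_statSol hf₁) hint (hbetween.mono fun _ h => h.1),
      integral_lt_integral_of_ae_lt hint (S.integrable_statSol hf₂) (hbetween.mono fun _ h => h.2)⟩

end

theorem bridging_lemma
    {Ω : Type} [MeasurableSpace Ω] (P : Measure Ω) (τ : ℝ → Ω → Ω)
    (a : ℝ → Ω → ℝ) (H : ℝ → ℝ → Ω → ℝ) (G_L G_U : ℝ → ℝ)
    (hset : HJSetting P τ a H G_L G_U)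
    (θ₁ θ₂ : ℝ) (hθ : θ₁ < θ₂) (hgap : Ioo θ₁ θ₂ ∩ Eset P τ a H = ∅)
    (lambar : ℝ) (f₁ f₂ : ℝ → Ω → ℝ)
    (hf₁ : StatSol P τ a H lambar f₁) (hf₂ : StatSol P τ a H lambar f₂)
    (hmean₁ : (∫ ω, f₁ 0 ω ∂P) = θ₁) (hmean₂ : (∫ ω, f₂ 0 ω ∂P) = θ₂) :
    ∃ Ωbar : Set Ω, MeasurableSet Ωbar ∧ P Ωbar = 1 ∧
      ∀ ω ∈ Ωbar, ∀ δ : ℚ, 0 < δ → δ < 1 →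
        (∃ z₁ z₂ : ℝ, z₁ < z₂ ∧ ∃ g g' : ℝ → ℝ,
          (∀ x ∈ Icc z₁ z₂, HasDerivWithinAt g (g' x) (Icc z₁ z₂) x) ∧
          ContinuousOn g' (Icc z₁ z₂) ∧
          (∀ x ∈ Icc z₁ z₂, a x ω * g' x + H (g x) x ω = lambar + (δ : ℝ)) ∧
          g z₁ = f₁ z₁ ω ∧ g z₂ = f₂ z₂ ω) ∧
        (∃ w₁ w₂ : ℝ, w₁ < w₂ ∧ ∃ h h' : ℝ → ℝ,
          (∀ x ∈ Icc w₁ w₂, HasDerivWithinAt h (h' x) (Icc w₁ w₂) x) ∧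
          ContinuousOn h' (Icc w₁ w₂) ∧
          (∀ x ∈ Icc w₁ w₂, a x ω * h' x + H (h x) x ω = lambar - (δ : ℝ)) ∧
          h w₁ = f₂ w₁ ω ∧ h w₂ = f₁ w₂ ω) := by
  have S := hset.stationaryEnv
  have := S.prob
  have hgap' : ∀ μ f, StatSol P τ a H μ f → ∫ ω, f 0 ω ∂P ∉ Ioo θ₁ θ₂ := fun μ f hf h =>
    eq_empty_iff_forall_notMem.1 hgap _ ⟨h, μ, f, hf, rfl⟩
  have hup : ∀ δ : ℚ, 0 < δ → ∀ᵐ ω ∂P, ∃ z₁ z₂ : ℝ, z₁ < z₂ ∧ ∃ g g' : ℝ → ℝ,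
      (∀ x ∈ Icc z₁ z₂, HasDerivWithinAt g (g' x) (Icc z₁ z₂) x) ∧
      ContinuousOn g' (Icc z₁ z₂) ∧
      (∀ x ∈ Icc z₁ z₂, a x ω * g' x + H (g x) x ω = lambar + (δ : ℝ)) ∧
      g z₁ = f₁ z₁ ω ∧ g z₂ = f₂ z₂ ω := fun δ hδ => by
    have hδ' : (0 : ℝ) < δ := by exact_mod_cast hδ
    refine S.ae_exists_bridge (by linarith) hf₁ hf₂ (by rwa [hmean₁, hmean₂]) fun f hf => ?_
    rw [hmean₁, hmean₂]
    exact hgap' _ f hf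
  have hdown : ∀ δ : ℚ, 0 < δ → ∀ᵐ ω ∂P, ∃ w₁ w₂ : ℝ, w₁ < w₂ ∧ ∃ h h' : ℝ → ℝ,
      (∀ x ∈ Icc w₁ w₂, HasDerivWithinAt h (h' x) (Icc w₁ w₂) x) ∧
      ContinuousOn h' (Icc w₁ w₂) ∧
      (∀ x ∈ Icc w₁ w₂, a x ω * h' x + H (h x) x ω = lambar - (δ : ℝ)) ∧
      h w₁ = f₂ w₁ ω ∧ h w₂ = f₁ w₂ ω := fun δ hδ => by
    have hδ' : (0 : ℝ) < δ := by exact_mod_cast hδ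
    have hbridge := S.reflect.ae_exists_bridge (lam := -lambar) (μ := -lambar + δ) (by linarith)
      hf₂.neg hf₁.neg (by simpa only [integral_neg, hmean₁, hmean₂, neg_lt_neg_iff] using hθ)
      fun f hf hmem => by
        have hneg := hf.neg
        simp only [neg_neg] at hneg
        refine hgap' _ _ hneg ?_
        simp only [integral_neg, hmean₁, hmean₂] at hmem ⊢
        exact ⟨lt_neg_of_lt_neg hmem.2, neg_lt_of_neg_lt hmem.1⟩
    filter_upwards [hbridge] with ω ⟨w₁, w₂, hw, g, g', hg, hg', hode, h₁, h₂⟩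
    refine ⟨w₁, w₂, hw, fun x => -g x, fun x => -g' x, fun x hx => (hg x hx).fun_neg, hg'.neg,
      fun x hx => ?_, neg_eq_iff_eq_neg.2 h₁, neg_eq_iff_eq_neg.2 h₂⟩
    linarith [hode x hx]
  have hall := ae_all_iff.2 fun δ : ℚ => ae_all_iff.2 fun hδ : 0 < δ =>
    (hup δ hδ).and (hdown δ hδ)
  obtain ⟨N, hsub, hN, hN0⟩ := exists_measurable_superset_of_null (ae_iff.1 hall)
  refine ⟨Nᶜ, hN.compl, (prob_compl_eq_one_iff hN).2 hN0, fun ω hω δ hδ _ => ?_⟩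
  by_contra h
  exact hω (hsub fun hω' => h (hω' δ hδ))
end

section
/- For every θ ∈ ℝ there exists a measurable set Ω_ue^θ ⊆ Ω with ℙ(Ω_ue^θ) = 1 such that the family of functions { x ↦ u_θ^ε(t,x,ω) : ε ∈ (0,1], t ∈ [0,∞), ω ∈ Ω_ue^θ } is uniformly equicontinuous: for every η > 0 there exists ρ > 0 such that |u_θ^ε(t,x,ω) − u_θ^ε(t,y,ω)| ≤ η whenever |x − y| ≤ ρ, ε ∈ (0,1], t ≥ 0 and ω ∈ Ω_ue^θ. -/
open MeasureTheory Filter Set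

def IsViscositySubsolution (alpha : ℝ → ℝ) (h : ℝ → ℝ → ℝ) (v : ℝ → ℝ → ℝ) : Prop :=
  ∀ t₀ x₀ : ℝ, 0 < t₀ →
    ∀ φ : ℝ × ℝ → ℝ, ContDiffOn ℝ 2 φ {q : ℝ × ℝ | 0 < q.1} →
      IsLocalMax (fun q : ℝ × ℝ => v q.1 q.2 - φ q) (t₀, x₀) →
      deriv (fun t => φ (t, x₀)) t₀ ≤
        alpha x₀ * deriv (deriv fun x => φ (t₀, x)) x₀ +
          h (deriv (fun x => φ (t₀, x)) x₀) x₀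

def IsViscositySupersolution (alpha : ℝ → ℝ) (h : ℝ → ℝ → ℝ) (v : ℝ → ℝ → ℝ) : Prop :=
  ∀ t₀ x₀ : ℝ, 0 < t₀ →
    ∀ φ : ℝ × ℝ → ℝ, ContDiffOn ℝ 2 φ {q : ℝ × ℝ | 0 < q.1} →
      IsLocalMin (fun q : ℝ × ℝ => v q.1 q.2 - φ q) (t₀, x₀) →
      alpha x₀ * deriv (deriv fun x => φ (t₀, x)) x₀ +
          h (deriv (fun x => φ (t₀, x)) x₀) x₀ ≤
        deriv (fun t => φ (t, x₀)) t₀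

def IsViscositySolution (alpha : ℝ → ℝ) (h : ℝ → ℝ → ℝ) (v : ℝ → ℝ → ℝ) : Prop :=
  IsViscositySubsolution alpha h v ∧ IsViscositySupersolution alpha h v

/-- A family of continuous maps is Borel measurable for the compact-open topology as soon as all
its evaluations are measurable. -/
theorem measurable_borel_continuousMap_of_eval {Ω X Y : Type*} [MeasurableSpace Ω]
    [TopologicalSpace X] [TopologicalSpace.PseudoMetrizableSpace X] [SecondCountableTopology X]
    [LocallyCompactSpace X]
    [PseudoMetricSpace Y] [SecondCountableTopology Y] [MeasurableSpace Y] [OpensMeasurableSpace Y]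
    {f : Ω → C(X, Y)} (hf : ∀ x, Measurable fun ω => f ω x) :
    @Measurable Ω C(X, Y) _ (borel C(X, Y)) f := by
  rw [borel_eq_generateFrom_of_subbasis ContinuousMap.compactOpen_eq]
  refine measurable_generateFrom ?_
  rintro _ ⟨K, hK, U, hU, rfl⟩
  obtain ⟨D, hDK, hDc, hKD⟩ :=
    (TopologicalSpace.IsSeparable.of_separableSpace K).exists_countable_dense_subset
  have key : f ⁻¹' {g : C(X, Y) | MapsTo g K U} =
      ⋃ n : ℕ, ⋂ x ∈ D, {ω | ((n : ENNReal) + 1)⁻¹ ≤ Metric.infEDist (f ω x) Uᶜ} := by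
    ext ω
    simp only [mem_preimage, mem_ofPred_eq, mem_iUnion, mem_iInter]
    constructor
    · intro hω
      rcases K.eq_empty_or_nonempty with rfl | hne
      · exact ⟨0, fun x hx => absurd (hDK hx) (by simp)⟩
      obtain ⟨x₀, hx₀, hmin⟩ := hK.exists_isMinOn hne
        (Metric.continuous_infEDist.comp (f ω).continuous : Continuous
          fun x => Metric.infEDist (f ω x) Uᶜ).continuousOn
      have hpos : 0 < Metric.infEDist (f ω x₀) Uᶜ := by
        rw [Metric.infEDist_pos_iff_notMem_closure, hU.isClosed_compl.closure_eq]
        exact fun hc => hc (hω hx₀)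
      obtain ⟨n, hn⟩ := ENNReal.exists_inv_nat_lt hpos.ne'
      refine ⟨n, fun x hx => le_trans ?_ (hmin (hDK hx))⟩
      exact (ENNReal.inv_le_inv.2 le_self_add).trans hn.le
    · rintro ⟨n, hn⟩ x hx
      have hcl : IsClosed {x | ((n : ENNReal) + 1)⁻¹ ≤ Metric.infEDist (f ω x) Uᶜ} :=
        isClosed_le continuous_const (Metric.continuous_infEDist.comp (f ω).continuous)
      have hle : ((n : ENNReal) + 1)⁻¹ ≤ Metric.infEDist (f ω x) Uᶜ :=
        closure_minimal (fun y hy => hn y hy) hcl (hKD hx)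
      by_contra hxU
      rw [Metric.infEDist_zero_of_mem (show f ω x ∈ Uᶜ from hxU)] at hle
      simp at hle
  rw [key]
  refine MeasurableSet.iUnion fun n => MeasurableSet.biInter hDc fun x _ => ?_
  exact measurableSet_le measurable_const (measurable_infEDist.comp (hf x))

/-- An oscillation bound at scale `δ` on a convex set propagates to scale `n * δ`. -/
theorem abs_sub_le_nat_mul_of_dist_le {E : Type*} [NormedAddCommGroup E] [NormedSpace ℝ E]
    {s : Set E} (hs : Convex ℝ s) {g : E → ℝ} {δ c : ℝ}
    (h : ∀ x ∈ s, ∀ y ∈ s, dist x y ≤ δ → |g x - g y| ≤ c) (n : ℕ) {x y : E}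
    (hx : x ∈ s) (hy : y ∈ s) (hxy : dist x y ≤ n * δ) : |g x - g y| ≤ n * c := by
  induction n generalizing y with
  | zero =>
    have : x = y := by simpa using hxy
    simp [this]
  | succ n ih =>
    push_cast at hxy ⊢
    have hn : (0 : ℝ) < n + 1 := by positivity
    have hz : AffineMap.lineMap x y ((n : ℝ) / (n + 1)) ∈ s :=
      hs.lineMap_mem hx hy ⟨by positivity, by rw [div_le_one hn]; linarith⟩
    have h1 := ih hz (by
      rw [dist_left_lineMap, Real.norm_of_nonneg (by positivity)]
      calc (n : ℝ) / (n + 1) * dist x y ≤ n / (n + 1) * ((n + 1) * δ) := by gcongr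
        _ = n * δ := by field_simp)
    have h2 := h _ hz _ hy (by
      have e : 1 - (n : ℝ) / (n + 1) = 1 / (n + 1) := by field_simp; ring
      rw [dist_lineMap_right, e, Real.norm_of_nonneg (by positivity)]
      calc 1 / ((n : ℝ) + 1) * dist x y ≤ 1 / (n + 1) * ((n + 1) * δ) := by gcongr
        _ = δ := by field_simp)
    calc |g x - g y| ≤ _ := abs_sub_le _ (g (AffineMap.lineMap x y ((n : ℝ) / (n + 1)))) _
      _ ≤ (n + 1) * c := by linarith

theorem isOpen_setOf_fst_pos : IsOpen {q : ℝ × ℝ | 0 < q.1} :=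
  isOpen_lt continuous_const continuous_fst

theorem hasDerivAt_fst_of_contDiffOn {φ : ℝ × ℝ → ℝ} {n : WithTop ℕ∞} (hn : n ≠ 0)
    (hφ : ContDiffOn ℝ n φ {q : ℝ × ℝ | 0 < q.1}) {q : ℝ × ℝ} (hq : 0 < q.1) :
    HasDerivAt (fun t => φ (t, q.2)) (fderiv ℝ φ q (1, 0)) q.1 := by
  have h1 : HasFDerivAt φ (fderiv ℝ φ q) q :=
    ((hφ.differentiableOn hn).differentiableAt (isOpen_setOf_fst_pos.mem_nhds hq)).hasFDerivAt
  exact h1.comp_hasDerivAt (f := fun t => (t, q.2)) q.1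
    ((hasDerivAt_id q.1).prodMk (hasDerivAt_const q.1 q.2))

theorem hasDerivAt_snd_of_contDiffOn {φ : ℝ × ℝ → ℝ} {n : WithTop ℕ∞} (hn : n ≠ 0)
    (hφ : ContDiffOn ℝ n φ {q : ℝ × ℝ | 0 < q.1}) {q : ℝ × ℝ} (hq : 0 < q.1) :
    HasDerivAt (fun x => φ (q.1, x)) (fderiv ℝ φ q (0, 1)) q.2 := by
  have h1 : HasFDerivAt φ (fderiv ℝ φ q) q :=
    ((hφ.differentiableOn hn).differentiableAt (isOpen_setOf_fst_pos.mem_nhds hq)).hasFDerivAt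
  exact h1.comp_hasDerivAt (f := fun x => (q.1, x)) q.2
    ((hasDerivAt_const q.2 q.1).prodMk (hasDerivAt_id q.2))

theorem contDiffOn_fderiv_apply {φ : ℝ × ℝ → ℝ}
    (hφ : ContDiffOn ℝ 2 φ {q : ℝ × ℝ | 0 < q.1}) (e : ℝ × ℝ) :
    ContDiffOn ℝ 1 (fun q => fderiv ℝ φ q e) {q : ℝ × ℝ | 0 < q.1} :=
  (hφ.fderiv_of_isOpen isOpen_setOf_fst_pos (by norm_num [one_add_one_eq_two])).clm_apply
    contDiffOn_const

theorem deriv_snd_eq_of_contDiffOn {φ : ℝ × ℝ → ℝ}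
    (hφ : ContDiffOn ℝ 2 φ {q : ℝ × ℝ | 0 < q.1}) {t : ℝ} (ht : 0 < t) :
    (deriv fun x => φ (t, x)) = fun x => fderiv ℝ φ (t, x) (0, 1) :=
  funext fun x => (hasDerivAt_snd_of_contDiffOn two_ne_zero hφ (q := (t, x)) ht).deriv

theorem continuousOn_deriv_fst {φ : ℝ × ℝ → ℝ}
    (hφ : ContDiffOn ℝ 2 φ {q : ℝ × ℝ | 0 < q.1}) :
    ContinuousOn (fun q : ℝ × ℝ => deriv (fun t => φ (t, q.2)) q.1) {q : ℝ × ℝ | 0 < q.1} :=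
  (contDiffOn_fderiv_apply hφ (1, 0)).continuousOn.congr fun _ hq =>
    (hasDerivAt_fst_of_contDiffOn two_ne_zero hφ hq).deriv

theorem continuousOn_deriv_snd {φ : ℝ × ℝ → ℝ}
    (hφ : ContDiffOn ℝ 2 φ {q : ℝ × ℝ | 0 < q.1}) :
    ContinuousOn (fun q : ℝ × ℝ => deriv (fun x => φ (q.1, x)) q.2) {q : ℝ × ℝ | 0 < q.1} :=
  (contDiffOn_fderiv_apply hφ (0, 1)).continuousOn.congr fun _ hq =>
    (hasDerivAt_snd_of_contDiffOn two_ne_zero hφ hq).deriv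

theorem hasDerivAt_deriv_snd_of_contDiffOn {φ : ℝ × ℝ → ℝ}
    (hφ : ContDiffOn ℝ 2 φ {q : ℝ × ℝ | 0 < q.1}) {q : ℝ × ℝ} (hq : 0 < q.1) :
    HasDerivAt (deriv fun x => φ (q.1, x))
      (fderiv ℝ (fun z => fderiv ℝ φ z (0, 1)) q (0, 1)) q.2 := by
  rw [deriv_snd_eq_of_contDiffOn hφ hq]
  exact hasDerivAt_snd_of_contDiffOn one_ne_zero (contDiffOn_fderiv_apply hφ (0, 1)) hq

theorem continuousOn_deriv_deriv_snd {φ : ℝ × ℝ → ℝ}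
    (hφ : ContDiffOn ℝ 2 φ {q : ℝ × ℝ | 0 < q.1}) :
    ContinuousOn (fun q : ℝ × ℝ => deriv (deriv fun x => φ (q.1, x)) q.2)
      {q : ℝ × ℝ | 0 < q.1} := by
  have h1 : ContinuousOn (fun q => fderiv ℝ (fun z => fderiv ℝ φ z (0, 1)) q (0, 1))
      {q : ℝ × ℝ | 0 < q.1} :=
    ((contDiffOn_fderiv_apply hφ (0, 1)).continuousOn_fderiv_of_isOpen isOpen_setOf_fst_pos
      le_rfl).clm_apply continuousOn_const
  exact h1.congr fun _ hq => (hasDerivAt_deriv_snd_of_contDiffOn hφ hq).deriv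

theorem deriv_quartic_add (f : ℝ → ℝ) {c x₀ : ℝ} (x : ℝ) (hf : DifferentiableAt ℝ f x) :
    deriv (fun x => f x + (c + (x - x₀) ^ 4)) x = deriv f x + 4 * (x - x₀) ^ 3 := by
  have h := hf.hasDerivAt.add ((((hasDerivAt_id x).sub_const x₀).pow 4).const_add c)
  exact h.deriv.trans (by simp)

/-- Subsolutions are stable under continuous convergence along an ultrafilter. -/
theorem isViscositySubsolution_of_tendsto {ι : Type*} (𝒰 : Ultrafilter ι)
    {αs : ι → ℝ → ℝ} {hs vs : ι → ℝ → ℝ → ℝ} {α : ℝ → ℝ} {h v : ℝ → ℝ → ℝ}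
    (hsub : ∀ i, IsViscositySubsolution (αs i) (hs i) (vs i))
    (hcont : ∀ i, ContinuousOn (fun q : ℝ × ℝ => vs i q.1 q.2) {q : ℝ × ℝ | 0 < q.1})
    (hα : ∀ x, Tendsto (fun z : ι × ℝ => αs z.1 z.2) (𝒰 ×ˢ nhds x) (nhds (α x)))
    (hh : ∀ q : ℝ × ℝ, Tendsto (fun z : ι × ℝ × ℝ => hs z.1 z.2.1 z.2.2) (𝒰 ×ˢ nhds q)
      (nhds (h q.1 q.2)))
    (hv : ∀ q : ℝ × ℝ, 0 < q.1 → Tendsto (fun z : ι × ℝ × ℝ => vs z.1 z.2.1 z.2.2)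
      (𝒰 ×ˢ nhds q) (nhds (v q.1 q.2))) :
    IsViscositySubsolution α h v := by
  intro t₀ x₀ ht₀ φ hφ hmax
  have hw : ContDiff ℝ 2 fun q : ℝ × ℝ => (q.1 - t₀) ^ 4 + (q.2 - x₀) ^ 4 := by fun_prop
  set ψ : ℝ × ℝ → ℝ := fun q => φ q + ((q.1 - t₀) ^ 4 + (q.2 - x₀) ^ 4) with hψdef
  have hψ : ContDiffOn ℝ 2 ψ {q : ℝ × ℝ | 0 < q.1} := hφ.add hw.contDiffOn
  have hU := isOpen_setOf_fst_pos
  have hq₀ : (t₀, x₀) ∈ {q : ℝ × ℝ | 0 < q.1} := ht₀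
  obtain ⟨r, hr, hrsub⟩ := Metric.nhds_basis_closedBall.mem_iff.1
    (inter_mem (hU.mem_nhds hq₀) hmax)
  set B := Metric.closedBall ((t₀, x₀) : ℝ × ℝ) r
  have hBc : IsCompact B := isCompact_closedBall _ _
  have hBne : B.Nonempty := ⟨_, Metric.mem_closedBall_self hr.le⟩
  have hmaxi : ∀ i, ∃ q ∈ B, IsMaxOn (fun q : ℝ × ℝ => vs i q.1 q.2 - ψ q) B q := fun i =>
    hBc.exists_isMaxOn hBne (((hcont i).sub hψ.continuousOn).mono fun q hq => (hrsub hq).1)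
  choose Q hQB hQmax using hmaxi
  obtain ⟨q, hqB, hq⟩ := isCompact_iff_ultrafilter_le_nhds.1 hBc (𝒰.map Q)
    (le_principal_iff.2 (show ∀ᶠ i in (𝒰 : Filter ι), Q i ∈ B from Eventually.of_forall hQB))
  have hQq : Tendsto Q 𝒰 (nhds q) := hq
  have hψcont : ∀ z, 0 < z.1 → ContinuousAt ψ z := fun z hz =>
    hψ.continuousOn.continuousAt (hU.mem_nhds hz)
  have hqpos : 0 < q.1 := (hrsub hqB).1
  have hq0 : q = (t₀, x₀) := by
    have l1 : Tendsto (fun i => vs i (Q i).1 (Q i).2 - ψ (Q i)) 𝒰 (nhds (v q.1 q.2 - ψ q)) :=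
      ((hv q hqpos).comp (tendsto_id.prodMk hQq)).sub ((hψcont q hqpos).tendsto.comp hQq)
    have l2 : Tendsto (fun i => vs i t₀ x₀ - ψ (t₀, x₀)) 𝒰 (nhds (v t₀ x₀ - ψ (t₀, x₀))) :=
      ((hv (t₀, x₀) ht₀).comp (tendsto_id.prodMk tendsto_const_nhds)).sub tendsto_const_nhds
    have l3 : v t₀ x₀ - ψ (t₀, x₀) ≤ v q.1 q.2 - ψ q :=
      le_of_tendsto_of_tendsto' l2 l1 fun i => hQmax i (Metric.mem_closedBall_self hr.le)
    have l4 : v q.1 q.2 - φ q ≤ v t₀ x₀ - φ (t₀, x₀) := (hrsub hqB).2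
    simp only [hψdef, sub_self] at l3
    have e1 : (q.1 - t₀) ^ 4 = 0 := by
      have := Even.pow_nonneg (by decide : Even 4) (q.1 - t₀)
      have := Even.pow_nonneg (by decide : Even 4) (q.2 - x₀)
      linarith
    have e2 : (q.2 - x₀) ^ 4 = 0 := by
      have := Even.pow_nonneg (by decide : Even 4) (q.2 - x₀)
      linarith
    exact Prod.ext (sub_eq_zero.1 (pow_eq_zero_iff (by norm_num) |>.1 e1))
      (sub_eq_zero.1 (pow_eq_zero_iff (by norm_num) |>.1 e2))
  subst hq0
  have hineq : ∀ᶠ i in (𝒰 : Filter ι), deriv (fun t => ψ (t, (Q i).2)) (Q i).1 ≤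
      αs i (Q i).2 * deriv (deriv fun x => ψ ((Q i).1, x)) (Q i).2 +
        hs i (deriv (fun x => ψ ((Q i).1, x)) (Q i).2) (Q i).2 := by
    filter_upwards [hQq (Metric.ball_mem_nhds _ hr)] with i hi
    exact hsub i _ _ (hrsub (hQB i)).1 ψ hψ ((hQmax i).isLocalMax
      (mem_of_superset (Metric.isOpen_ball.mem_nhds hi) Metric.ball_subset_closedBall))
  have c1 := ((continuousOn_deriv_fst hψ).continuousAt (hU.mem_nhds hq₀)).tendsto.comp hQq
  have c2 := ((continuousOn_deriv_snd hψ).continuousAt (hU.mem_nhds hq₀)).tendsto.comp hQq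
  have c3 := ((continuousOn_deriv_deriv_snd hψ).continuousAt (hU.mem_nhds hq₀)).tendsto.comp hQq
  have cx : Tendsto (fun i => (Q i).2) 𝒰 (nhds x₀) := (continuous_snd.tendsto _).comp hQq
  have c4 := (hα x₀).comp (tendsto_id.prodMk cx)
  have c5 := (hh (deriv (fun x => ψ (t₀, x)) x₀, x₀)).comp
    (tendsto_id.prodMk (c2.prodMk_nhds cx))
  have hlim := le_of_tendsto_of_tendsto c1 ((c4.mul c3).add c5) hineq
  have hφt : DifferentiableAt ℝ (fun t => φ (t, x₀)) t₀ :=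
    (hasDerivAt_fst_of_contDiffOn two_ne_zero hφ (q := (t₀, x₀)) ht₀).differentiableAt
  have hφx : ∀ x, DifferentiableAt ℝ (fun x => φ (t₀, x)) x := fun x =>
    (hasDerivAt_snd_of_contDiffOn two_ne_zero hφ (q := (t₀, x)) ht₀).differentiableAt
  have d1 : deriv (fun t => ψ (t, x₀)) t₀ = deriv (fun t => φ (t, x₀)) t₀ := by
    have := deriv_quartic_add (fun t => φ (t, x₀)) (c := (x₀ - x₀) ^ 4) (x₀ := t₀) t₀ hφt
    simpa [hψdef, add_comm] using this
  have d2 : (deriv fun x => ψ (t₀, x)) =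
      fun x => deriv (fun x => φ (t₀, x)) x + 4 * (x - x₀) ^ 3 :=
    funext fun x => deriv_quartic_add (fun x => φ (t₀, x)) (c := (t₀ - t₀) ^ 4) (x₀ := x₀) x (hφx x)
  have d3 : deriv (deriv fun x => ψ (t₀, x)) x₀ = deriv (deriv fun x => φ (t₀, x)) x₀ := by
    rw [d2]
    have h1 := (hasDerivAt_deriv_snd_of_contDiffOn hφ (q := (t₀, x₀)) ht₀)
    have h2 := h1.add ((((hasDerivAt_id x₀).sub_const x₀).pow 3).const_mul 4)
    have h3 := h2.deriv
    rw [← h1.deriv] at h3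
    exact h3.trans (by simp)
  have d4 : deriv (fun x => ψ (t₀, x)) x₀ = deriv (fun x => φ (t₀, x)) x₀ := by
    rw [d2]; simp
  simp only [d1, d3, d4] at hlim
  exact hlim

theorem IsViscositySupersolution.neg {α : ℝ → ℝ} {h v : ℝ → ℝ → ℝ}
    (hv : IsViscositySupersolution α h v) :
    IsViscositySubsolution α (fun p x => -h (-p) x) fun t x => -v t x := by
  intro t₀ x₀ ht₀ φ hφ hmax
  have := hv t₀ x₀ ht₀ (fun q => -φ q) hφ.neg (by
    refine hmax.neg.congr (Eventually.of_forall fun q => ?_)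
    simp; ring)
  simp only [deriv.fun_neg, deriv.fun_neg'] at this
  linarith

theorem IsViscositySubsolution.neg {α : ℝ → ℝ} {h v : ℝ → ℝ → ℝ}
    (hv : IsViscositySubsolution α (fun p x => -h (-p) x) fun t x => -v t x) :
    IsViscositySupersolution α h v := by
  intro t₀ x₀ ht₀ φ hφ hmin
  have := hv t₀ x₀ ht₀ (fun q => -φ q) hφ.neg (by
    refine hmin.neg.congr (Eventually.of_forall fun q => ?_)
    simp; ring)
  simp only [deriv.fun_neg, deriv.fun_neg', neg_neg] at this
  linarith

theorem isViscositySolution_of_tendsto {ι : Type*} (𝒰 : Ultrafilter ι)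
    {αs : ι → ℝ → ℝ} {hs vs : ι → ℝ → ℝ → ℝ} {α : ℝ → ℝ} {h v : ℝ → ℝ → ℝ}
    (hsol : ∀ i, IsViscositySolution (αs i) (hs i) (vs i))
    (hcont : ∀ i, ContinuousOn (fun q : ℝ × ℝ => vs i q.1 q.2) {q : ℝ × ℝ | 0 < q.1})
    (hα : ∀ x, Tendsto (fun z : ι × ℝ => αs z.1 z.2) (𝒰 ×ˢ nhds x) (nhds (α x)))
    (hh : ∀ q : ℝ × ℝ, Tendsto (fun z : ι × ℝ × ℝ => hs z.1 z.2.1 z.2.2) (𝒰 ×ˢ nhds q)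
      (nhds (h q.1 q.2)))
    (hv : ∀ q : ℝ × ℝ, 0 < q.1 → Tendsto (fun z : ι × ℝ × ℝ => vs z.1 z.2.1 z.2.2)
      (𝒰 ×ˢ nhds q) (nhds (v q.1 q.2))) :
    IsViscositySolution α h v := by
  refine ⟨isViscositySubsolution_of_tendsto 𝒰 (fun i => (hsol i).1) hcont hα hh hv,
    IsViscositySubsolution.neg (isViscositySubsolution_of_tendsto 𝒰 (fun i => (hsol i).2.neg)
      (fun i => (hcont i).neg) hα (fun q => ?_) fun q hq => (hv q hq).neg)⟩
  have hm : Tendsto (fun z : ι × ℝ × ℝ => (z.1, (-z.2.1, z.2.2))) (𝒰 ×ˢ nhds q)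
      (𝒰 ×ˢ nhds (-q.1, q.2)) :=
    tendsto_fst.prodMk (((by fun_prop : Continuous fun y : ℝ × ℝ => (-y.1, y.2)).tendsto q).comp
      tendsto_snd)
  exact ((hh (-q.1, q.2)).comp hm).neg

theorem IsViscositySubsolution.translate {α : ℝ → ℝ} {h v : ℝ → ℝ → ℝ}
    (hv : IsViscositySubsolution α h v) (z c : ℝ) :
    IsViscositySubsolution (fun x => α (x + z)) (fun p x => h p (x + z))
      fun t x => v t (x + z) - c := by
  intro t₀ x₀ ht₀ φ hφ hmax
  have htr : ContDiff ℝ 2 fun q : ℝ × ℝ => (q.1, q.2 - z) := by fun_prop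
  have hloc : IsLocalMax (fun q : ℝ × ℝ => v q.1 q.2 - φ (q.1, q.2 - z)) (t₀, x₀ + z) := by
    have ht : Tendsto (fun q : ℝ × ℝ => (q.1, q.2 - z)) (nhds (t₀, x₀ + z)) (nhds (t₀, x₀)) := by
      simpa using htr.continuous.tendsto (t₀, x₀ + z)
    filter_upwards [ht hmax] with q hq
    simp only [mem_preimage, mem_ofPred_eq, sub_add_cancel, add_sub_cancel_right] at hq ⊢
    linarith
  have := hv t₀ (x₀ + z) ht₀ _ (hφ.comp htr.contDiffOn fun q hq => hq) hloc
  have e (t : ℝ) : (deriv fun x => φ (t, x - z)) = fun x => deriv (fun x => φ (t, x)) (x - z) :=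
    funext fun x => deriv_comp_sub_const (f := fun x => φ (t, x)) z x
  simpa [Function.comp_def, e, deriv_comp_sub_const] using this
theorem exists_ultrafilter_of_mem_closure_image {Ω X : Type*} [TopologicalSpace X] {f : Ω → X}
    {x : X} {D : ℕ → Set Ω} (hD : Antitone D) (h : ∀ k, x ∈ closure (f '' D k)) :
    ∃ 𝒰 : Ultrafilter Ω, (∀ k, D k ∈ 𝒰) ∧ Tendsto f 𝒰 (nhds x) := by
  have hne : NeBot (⨅ k, comap f (nhds x) ⊓ 𝓟 (D k)) := by
    refine iInf_neBot_of_directed' ?_ fun k => ?_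
    · exact Antitone.directed_ge fun i j hij =>
        inf_le_inf_left _ (principal_mono.2 (hD hij))
    · have := mem_closure_iff_clusterPt.1 (h k)
      rw [ClusterPt, ← Filter.map_principal, ← Filter.push_pull'] at this
      exact NeBot.of_map this
  refine ⟨Ultrafilter.of (⨅ k, comap f (nhds x) ⊓ 𝓟 (D k)), fun k => ?_, ?_⟩
  · exact (Ultrafilter.of_le _).trans ((iInf_le _ k).trans inf_le_right) (mem_principal_self _)
  · exact tendsto_iff_comap.2 ((Ultrafilter.of_le _).trans ((iInf_le _ 0).trans inf_le_left))

/-- Arzelà–Ascoli along an ultrafilter: functions sharing asymptotically a modulus of continuity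
on a convex set, and normalized at a point, converge continuously. -/
theorem exists_tendsto_of_modulus {ι E : Type*} [NormedAddCommGroup E] [NormedSpace ℝ E]
    (𝒰 : Ultrafilter ι) {s : Set E} (hs : Convex ℝ s) {w : ι → E → ℝ} {δ : ℕ → ℝ} {c : ℕ → ℝ}
    (hδ : ∀ k, 0 < δ k) (hc : Tendsto c atTop (nhds 0))
    (hw : ∀ k, ∀ᶠ i in (𝒰 : Filter ι), ∀ x ∈ s, ∀ y ∈ s, dist x y ≤ δ k →
      |w i x - w i y| ≤ c k)
    {x₀ : E} (hx₀ : x₀ ∈ s) {b : ℝ} (hb : ∀ i, w i x₀ = b) :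
    ∃ v : E → ℝ, (∀ x ∈ s, Tendsto (fun i => w i x) 𝒰 (nhds (v x))) ∧
      (∀ x ∈ s, Tendsto (fun z : ι × E => w z.1 z.2) (𝒰 ×ˢ nhdsWithin x s) (nhds (v x))) ∧
      ∀ k, ∀ x ∈ s, ∀ y ∈ s, dist x y ≤ δ k → |v x - v y| ≤ c k := by
  have hlim : ∀ x, ∃ y, x ∈ s → Tendsto (fun i => w i x) 𝒰 (nhds y) := by
    intro x
    by_cases hx : x ∈ s
    swap
    · exact ⟨0, fun h => absurd h hx⟩
    obtain ⟨n, hn⟩ := exists_nat_ge (dist x x₀ / δ 0)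
    have hbd : ∀ᶠ i in (𝒰 : Filter ι), w i x ∈ Icc (b - n * c 0) (b + n * c 0) := by
      filter_upwards [hw 0] with i hi
      have := abs_le.1 (abs_sub_le_nat_mul_of_dist_le hs hi n hx hx₀
        ((div_le_iff₀ (hδ 0)).1 hn))
      rw [hb i] at this
      exact ⟨by linarith [this.1], by linarith [this.2]⟩
    obtain ⟨y, -, hy⟩ := isCompact_iff_ultrafilter_le_nhds.1 isCompact_Icc
      (𝒰.map fun i => w i x) (le_principal_iff.2 hbd)
    exact ⟨y, fun _ => hy⟩
  choose v hv using hlim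
  refine ⟨v, hv, fun x hx => ?_, fun k x hx y hy hxy => ?_⟩
  · rw [Metric.tendsto_nhds]
    intro η hη
    obtain ⟨k, hk⟩ := ((hc.eventually (gt_mem_nhds (half_pos hη)))).exists
    have h1 : ∀ᶠ z : E in nhdsWithin x s, z ∈ s ∧ dist z x ≤ δ k :=
      (eventually_mem_nhdsWithin).and
        (mem_nhdsWithin_of_mem_nhds (Metric.closedBall_mem_nhds x (hδ k)))
    have h2 := Metric.tendsto_nhds.1 (hv x hx) _ (half_pos hη)
    filter_upwards [((hw k).and h2).prod_mk h1] with z hz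
    obtain ⟨⟨hz1, hz2⟩, hz3, hz4⟩ := hz
    have := hz1 z.2 hz3 x hx hz4
    rw [← Real.dist_eq] at this
    linarith [dist_triangle (w z.1 z.2) (w z.1 x) (v x)]
  · refine le_of_tendsto ((hv x hx).sub (hv y hy)).abs ?_
    filter_upwards [hw k] with i hi using hi x hx y hy hxy

/-- Diagonal selection in a countable family of increasing covers by arbitrary sets, with control
of the outer measure of all finite intersections. -/
theorem exists_seq_lt_measure_biInter {Ω : Type*} [MeasurableSpace Ω] (P : Measure Ω)
    {C : ℕ → ℕ → Set Ω} (hmono : ∀ k, Monotone (C k)) (hcov : ∀ k, ⋃ n, C k n = univ)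
    {c : ENNReal} (hc : c < P univ) :
    ∃ N : ℕ → ℕ, ∀ k, c < P (⋂ j < k, C j (N j)) := by
  have step : ∀ (k : ℕ) (D : {D : Set Ω // c < P D}), ∃ n, c < P (D ∩ C k n) := by
    rintro k ⟨D, hD⟩
    have hm : Monotone fun n => D ∩ C k n := fun _ _ h => inter_subset_inter_right _ (hmono k h)
    have := hm.measure_iUnion (μ := P)
    rw [← inter_iUnion, hcov, inter_univ] at this
    rw [this] at hD
    exact lt_iSup_iff.1 hD
  choose n hn using step
  let D : ℕ → {D : Set Ω // c < P D} := fun k =>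
    Nat.rec ⟨univ, hc⟩ (fun k D => ⟨D ∩ C k (n k D), hn k D⟩) k
  have hD : ∀ k, (D k).1 = ⋂ j < k, C j (n j (D j)) := by
    intro k
    induction k with
    | zero => simp [D]
    | succ k ih =>
      rw [biInter_lt_succ, ← ih]
  exact ⟨fun j => n j (D j), fun k => hD k ▸ (D k).2⟩

namespace HJSetting

variable {Ω : Type} [MeasurableSpace Ω] {P : Measure Ω} {τ : ℝ → Ω → Ω} {a : ℝ → Ω → ℝ}
  {H : ℝ → ℝ → Ω → ℝ} {G_L G_U : ℝ → ℝ}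

theorem a_shift (hset : HJSetting P τ a H G_L G_U) (x z : ℝ) (ω : Ω) :
    a x (τ z ω) = a (x + z) ω := by
  rw [hset.a_stat x, hset.a_stat (x + z), hset.tau_add]

theorem H_shift (hset : HJSetting P τ a H G_L G_U) (p x z : ℝ) (ω : Ω) :
    H p x (τ z ω) = H p (x + z) ω := by
  rw [hset.H_stat p x, hset.H_stat p (x + z), hset.tau_add]

theorem continuous_a_s14 (hset : HJSetting P τ a H G_L G_U) (ω : Ω) :
    Continuous fun x => a x ω := by
  obtain ⟨κ, hκ, hlip⟩ := hset.a_sqrt_lip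
  have h1 : LipschitzWith ⟨κ, hκ.le⟩ fun x => Real.sqrt (a x ω) := by
    refine LipschitzWith.of_dist_le_mul fun x y => ?_
    have := hlip (x - y) (τ y ω)
    rw [hset.a_shift, hset.a_shift, sub_add_cancel, zero_add] at this
    exact this
  exact (h1.continuous.pow 2).congr fun x => Real.sq_sqrt (hset.a_pos x ω).le

theorem continuous_H_s14 (hset : HJSetting P τ a H G_L G_U) (ω : Ω) :
    Continuous fun q : ℝ × ℝ => H q.1 q.2 ω := by
  refine continuous_iff_continuousAt.2 fun q₀ => Metric.tendsto_nhds.2 fun η hη => ?_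
  obtain ⟨p₀, x₀⟩ := q₀
  have hR : 0 < |p₀| + 1 := by positivity
  obtain ⟨K, hK, hlip⟩ := hset.H_lip _ hR
  obtain ⟨m, -, -, hm0, hm⟩ := hset.H_mod _ hR
  have hmη := hm0.eventually (gt_mem_nhds (half_pos hη))
  obtain ⟨r, hr, hmr⟩ := mem_nhdsGT_iff_exists_Ioo_subset.1 hmη
  have e1 : ∀ᶠ q : ℝ × ℝ in nhds (p₀, x₀), |q.1 - p₀| < 1 ∧ K * |q.1 - p₀| < η / 2 ∧
      |q.2 - x₀| < r := by
    have c1 : Tendsto (fun q : ℝ × ℝ => |q.1 - p₀|) (nhds (p₀, x₀)) (nhds 0) := by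
      have : Continuous fun q : ℝ × ℝ => |q.1 - p₀| := by fun_prop
      simpa using this.tendsto (p₀, x₀)
    have c2 : Tendsto (fun q : ℝ × ℝ => |q.2 - x₀|) (nhds (p₀, x₀)) (nhds 0) := by
      have : Continuous fun q : ℝ × ℝ => |q.2 - x₀| := by fun_prop
      simpa using this.tendsto (p₀, x₀)
    have c3 : Tendsto (fun q : ℝ × ℝ => K * |q.1 - p₀|) (nhds (p₀, x₀)) (nhds 0) := by
      simpa using c1.const_mul K
    exact (c1.eventually (gt_mem_nhds one_pos)).and
      ((c3.eventually (gt_mem_nhds (half_pos hη))).and (c2.eventually (gt_mem_nhds hr)))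
  filter_upwards [e1] with q hq
  obtain ⟨h1, h2, h3⟩ := hq
  have hqR : |q.1| ≤ |p₀| + 1 := by
    have := abs_sub_abs_le_abs_sub q.1 p₀
    linarith
  have b1 : |H q.1 q.2 ω - H q.1 x₀ ω| < η / 2 := by
    rcases eq_or_ne q.2 x₀ with he | hne
    · rw [he]; simpa using hη
    · have := hm q.1 (q.2 - x₀) (τ x₀ ω) hqR
      rw [hset.H_shift, hset.H_shift, sub_add_cancel, zero_add] at this
      exact this.trans_lt (hmr ⟨abs_pos.2 (sub_ne_zero.2 hne), h3⟩)
  have b2 : |H q.1 x₀ ω - H p₀ x₀ ω| ≤ K * |q.1 - p₀| := by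
    have := hlip q.1 p₀ (τ x₀ ω) hqR (by linarith)
    rwa [hset.H_shift, hset.H_shift, zero_add] at this
  rw [Real.dist_eq]
  linarith [abs_sub_le (H q.1 q.2 ω) (H q.1 x₀ ω) (H p₀ x₀ ω)]

end HJSetting

theorem IsViscositySolution.translate {α : ℝ → ℝ} {h v : ℝ → ℝ → ℝ}
    (hv : IsViscositySolution α h v) (z c : ℝ) :
    IsViscositySolution (fun x => α (x + z)) (fun p x => h p (x + z))
      fun t x => v t (x + z) - c := by
  refine ⟨hv.1.translate z c, IsViscositySubsolution.neg ?_⟩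
  have := hv.2.neg.translate z (-c)
  convert this using 3
  ring

/-- The solutions with linear data are stationary up to the linear drift. -/
theorem HJSetting.solution_shift {Ω : Type} [MeasurableSpace Ω] {P : Measure Ω}
    {τ : ℝ → Ω → Ω} {a : ℝ → Ω → ℝ} {H : ℝ → ℝ → Ω → ℝ} {G_L G_U : ℝ → ℝ}
    (hset : HJSetting P τ a H G_L G_U) {w : Ω → ℝ → ℝ → ℝ} {θ : ℝ}
    (hsol : ∀ ω, IsViscositySolution (fun x => a x ω) (fun p x => H p x ω) (w ω))
    (huc : ∀ ω, UniformContinuousOn (fun q : ℝ × ℝ => w ω q.1 q.2) {q : ℝ × ℝ | 0 ≤ q.1})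
    (hinit : ∀ ω x, w ω 0 x = θ * x)
    (huniq : ∀ ω (v : ℝ → ℝ → ℝ),
      IsViscositySolution (fun x => a x ω) (fun p x => H p x ω) v →
      UniformContinuousOn (fun q : ℝ × ℝ => v q.1 q.2) {q : ℝ × ℝ | 0 ≤ q.1} →
      (∀ x, v 0 x = θ * x) → ∀ t x, 0 ≤ t → v t x = w ω t x)
    (z : ℝ) (ω : Ω) {t : ℝ} (ht : 0 ≤ t) (x : ℝ) :
    w (τ z ω) t x = w ω t (x + z) - θ * z := by
  refine (huniq (τ z ω) (fun t x => w ω t (x + z) - θ * z) ?_ ?_ (fun x => ?_) t x ht).symm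
  · simp only [hset.a_shift, hset.H_shift]
    exact (hsol ω).translate z _
  · have hmap : UniformContinuous fun q : ℝ × ℝ => (q.1, q.2 + z) :=
      uniformContinuous_fst.prodMk (uniformContinuous_snd.add_const z)
    rw [Metric.uniformContinuousOn_iff]
    intro η hη
    obtain ⟨δ, hδ, h⟩ := Metric.uniformContinuousOn_iff.1 (huc ω) η hη
    refine ⟨δ, hδ, fun q hq q' hq' hd => ?_⟩
    have := h (q.1, q.2 + z) hq (q'.1, q'.2 + z) hq' (by simpa [Prod.dist_eq] using hd)
    simpa using this
  · simp only [hinit]; ring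

/-- Rescaling: an oscillation bound for `g` at one scale gives one for `ε * g (· / ε)`,
uniformly in `ε ∈ (0, 1]`. -/
theorem abs_rescale_sub_le {g : ℝ → ℝ} {δ c : ℝ} (hδ : 0 < δ)
    (h : ∀ x y, |x - y| ≤ δ → |g x - g y| ≤ c) {ε : ℝ} (hε : 0 < ε) (hε1 : ε ≤ 1) {x y : ℝ}
    (hxy : |x - y| ≤ δ) : |ε * g (x / ε) - ε * g (y / ε)| ≤ 2 * c := by
  have hc : 0 ≤ c := (abs_nonneg _).trans (h 0 0 (by simpa using hδ.le))
  have hd : dist (x / ε) (y / ε) ≤ (⌈1 / ε⌉₊ : ℝ) * δ := by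
    rw [Real.dist_eq, ← sub_div, abs_div, abs_of_pos hε]
    calc |x - y| / ε ≤ δ / ε := by gcongr
      _ = 1 / ε * δ := by ring
      _ ≤ ⌈1 / ε⌉₊ * δ := by gcongr; exact Nat.le_ceil _
  have hmain := abs_sub_le_nat_mul_of_dist_le (g := g) convex_univ
    (fun x _ y _ hxy => h x y hxy) _ (mem_univ _) (mem_univ _) hd
  have hceil : (⌈1 / ε⌉₊ : ℝ) < 1 / ε + 1 := Nat.ceil_lt_add_one (by positivity)
  rw [← mul_sub, abs_mul, abs_of_pos hε]
  calc ε * |g (x / ε) - g (y / ε)| ≤ ε * ((1 / ε + 1) * c) := by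
        gcongr
        exact hmain.trans (by gcongr)
    _ = (1 + ε) * c := by field_simp
    _ ≤ 2 * c := by gcongr; linarith

theorem uniform_equicontinuity_in_space
    {Ω : Type} [MeasurableSpace Ω] (P : Measure Ω) (τ : ℝ → Ω → Ω)
    (a : ℝ → Ω → ℝ) (H : ℝ → ℝ → Ω → ℝ) (G_L G_U : ℝ → ℝ)
    (hset : HJSetting P τ a H G_L G_U)
    (u : ℝ → Ω → ℝ → ℝ → ℝ)
    (hu_sol : ∀ θ ω, IsViscositySolution (fun x => a x ω) (fun p x => H p x ω) (u θ ω))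
    (hu_uc : ∀ θ ω, UniformContinuousOn (fun q : ℝ × ℝ => u θ ω q.1 q.2) {q : ℝ × ℝ | 0 ≤ q.1})
    (hu_init : ∀ θ ω x, u θ ω 0 x = θ * x)
    (hu_unique : ∀ θ ω (v : ℝ → ℝ → ℝ),
      IsViscositySolution (fun x => a x ω) (fun p x => H p x ω) v →
      UniformContinuousOn (fun q : ℝ × ℝ => v q.1 q.2) {q : ℝ × ℝ | 0 ≤ q.1} →
      (∀ x, v 0 x = θ * x) → ∀ t x, 0 ≤ t → v t x = u θ ω t x)
    (θ : ℝ) :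
    ∃ Ωue : Set Ω, MeasurableSet Ωue ∧ P Ωue = 1 ∧
      ∀ η > (0:ℝ), ∃ ρ > (0:ℝ), ∀ ε : ℝ, 0 < ε → ε ≤ 1 → ∀ t ≥ (0:ℝ), ∀ ω ∈ Ωue,
        ∀ x y : ℝ, |x - y| ≤ ρ →
          |ε * u θ ω (t / ε) (x / ε) - ε * u θ ω (t / ε) (y / ε)| ≤ η := by
  have := hset.prob
  let f : Ω → C(ℝ × ℝ, ℝ × ℝ) := fun ω =>
    ⟨fun q => (a q.2 ω, H q.1 q.2 ω),
      ((hset.continuous_a_s14 ω).comp continuous_snd).prodMk (hset.continuous_H_s14 ω)⟩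
  have hf : @Measurable Ω C(ℝ × ℝ, ℝ × ℝ) _ (borel _) f :=
    measurable_borel_continuousMap_of_eval fun q =>
      (hset.meas_a.comp (measurable_const.prodMk measurable_id)).prodMk
        (hset.meas_H.comp (measurable_const.prodMk (measurable_const.prodMk measurable_id)))
  set S : Set (ℝ × ℝ) := {q | 0 ≤ q.1}
  have hSconv : Convex ℝ S := (convex_Ici (0 : ℝ)).linear_preimage (LinearMap.fst ℝ ℝ ℝ)
  have h0S : (0 : ℝ × ℝ) ∈ S := le_refl (0 : ℝ)
  let C : ℕ → ℕ → Set Ω := fun k n => {ω | ∀ q ∈ S, ∀ q' ∈ S, dist q q' ≤ 1 / ((n : ℝ) + 1) →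
    |u θ ω q.1 q.2 - u θ ω q'.1 q'.2| ≤ 1 / ((k : ℝ) + 1)}
  have hmono : ∀ k, Monotone (C k) := fun k n n' hn ω hω q hq q' hq' hd =>
    hω q hq q' hq' (hd.trans (Nat.one_div_le_one_div hn))
  have hcov : ∀ k, ⋃ n, C k n = univ := fun k => eq_univ_of_forall fun ω => by
    obtain ⟨δ, hδ, h⟩ := Metric.uniformContinuousOn_iff.1 (hu_uc θ ω) (1 / ((k : ℝ) + 1))
      Nat.one_div_pos_of_nat
    obtain ⟨n, hn⟩ := exists_nat_one_div_lt hδ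
    exact mem_iUnion.2 ⟨n, fun q hq q' hq' hd => (h q hq q' hq' (hd.trans_lt hn)).le⟩
  obtain ⟨N, hN⟩ := exists_seq_lt_measure_biInter P hmono hcov (c := 1 / 2)
    (by rw [measure_univ]; exact ENNReal.half_lt_self one_ne_zero ENNReal.one_ne_top)
  let D : ℕ → Set Ω := fun k => ⋂ j < k, C j (N j)
  have hDanti : Antitone D := fun i j hij => biInter_subset_biInter_left fun l hl =>
    lt_of_lt_of_le hl hij
  let B : ℕ → Set Ω := fun k => f ⁻¹' closure (f '' D k)
  have hBanti : Antitone B := fun i j hij =>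
    preimage_mono (closure_mono (image_mono (hDanti hij)))
  have hBmeas : ∀ k, MeasurableSet (B k) := fun k =>
    hf (MeasurableSpace.measurableSet_generateFrom isClosed_closure.isOpen_compl).of_compl
  set A : Set Ω := ⋂ k, B k with hA
  have hAmeas : MeasurableSet A := MeasurableSet.iInter hBmeas
  have hAC : A = ⋂ k, C k (N k) := by
    refine Subset.antisymm (fun ω hω => ?_) fun ω hω => ?_
    · obtain ⟨𝒰, hD, hlim⟩ := exists_ultrafilter_of_mem_closure_image (f := f) (x := f ω) hDanti
        fun k => mem_iInter.1 hω k
      obtain ⟨v, hv, hvc, hvmod⟩ := exists_tendsto_of_modulus 𝒰 hSconv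
        (w := fun ω q => u θ ω q.1 q.2) (δ := fun k => 1 / ((N k : ℝ) + 1))
        (c := fun k => 1 / ((k : ℝ) + 1)) (fun k => Nat.one_div_pos_of_nat)
        tendsto_one_div_add_atTop_nhds_zero_nat
        (fun k => mem_of_superset (hD (k + 1)) fun ω' hω' =>
          mem_iInter₂.1 hω' k (Nat.lt_succ_self k))
        h0S (b := 0) (fun ω' => by simp [hu_init])
      have hfc : ∀ q, Tendsto (fun z : Ω × ℝ × ℝ => f z.1 z.2) (𝒰 ×ˢ nhds q)
          (nhds (f ω q)) := fun q => by
        have h1 : Tendsto (fun z : Ω × ℝ × ℝ => (f z.1, z.2)) (𝒰 ×ˢ nhds q)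
            (nhds (f ω, q)) := by
          exact (hlim.comp tendsto_fst).prodMk_nhds tendsto_snd
        exact (ContinuousEval.continuous_eval.tendsto (f ω, q)).comp h1
      have hsol : IsViscositySolution (fun x => a x ω) (fun p x => H p x ω)
          fun t x => v (t, x) := by
        refine isViscositySolution_of_tendsto 𝒰 (fun ω' => hu_sol θ ω')
          (fun ω' => (hu_uc θ ω').continuousOn.mono fun q (hq : 0 < q.1) => hq.le) (fun x => ?_)
          (fun q => ((continuous_snd.tendsto _).comp (hfc q))) fun q hq => ?_
        · have h1 : Tendsto (fun z : Ω × ℝ => (z.1, ((0 : ℝ), z.2))) (𝒰 ×ˢ nhds x)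
              (𝒰 ×ˢ nhds (0, x)) :=
            tendsto_fst.prodMk (((by fun_prop : Continuous fun y : ℝ => ((0 : ℝ), y)).tendsto
              x).comp tendsto_snd)
          exact (continuous_fst.tendsto _).comp ((hfc (0, x)).comp h1)
        · have := hvc q (le_of_lt hq)
          have hSq : S ∈ nhds q := mem_of_superset (isOpen_setOf_fst_pos.mem_nhds hq)
            fun z (hz : 0 < z.1) => hz.le
          rwa [nhdsWithin_eq_nhds.2 hSq] at this
      have hvuc : UniformContinuousOn (fun q : ℝ × ℝ => v (q.1, q.2)) S := by
        refine Metric.uniformContinuousOn_iff.2 fun η hη => ?_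
        obtain ⟨k, hk⟩ := exists_nat_one_div_lt hη
        exact ⟨1 / ((N k : ℝ) + 1), Nat.one_div_pos_of_nat, fun q hq q' hq' hd =>
          (hvmod k q hq q' hq' hd.le).trans_lt hk⟩
      have hvinit : ∀ x, v (0, x) = θ * x := fun x =>
        tendsto_nhds_unique (hv (0, x) (le_refl (0 : ℝ)))
          (by simp only [hu_init]; exact tendsto_const_nhds)
      have hvu := hu_unique θ ω (fun t x => v (t, x)) hsol hvuc hvinit
      refine mem_iInter.2 fun k q hq q' hq' hd => ?_
      rw [← hvu _ _ hq, ← hvu _ _ hq']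
      exact hvmod k q hq q' hq' hd
    · refine mem_iInter.2 fun k => subset_closure (mem_image_of_mem f ?_)
      exact mem_iInter₂.2 fun j _ => mem_iInter.1 hω j
  have hshift : ∀ z, A ⊆ τ z ⁻¹' A := by
    intro z ω hω
    rw [hAC] at hω
    rw [mem_preimage, hAC]
    refine mem_iInter.2 fun k q hq q' hq' hd => ?_
    rw [hset.solution_shift (hu_sol θ) (hu_uc θ) (hu_init θ) (hu_unique θ) z ω hq,
      hset.solution_shift (hu_sol θ) (hu_uc θ) (hu_init θ) (hu_unique θ) z ω hq',
      sub_sub_sub_cancel_right]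
    exact mem_iInter.1 hω k (q.1, q.2 + z) hq (q'.1, q'.2 + z) hq'
      (by simpa [Prod.dist_eq] using hd)
  have hinv : ∀ z, τ z ⁻¹' A = A := fun z => by
    refine Subset.antisymm (fun ω hω => ?_) (hshift z)
    have := hshift (-z) hω
    rwa [mem_preimage, ← hset.tau_add, neg_add_cancel, hset.tau_zero] at this
  have hPA : 1 / 2 ≤ P A := by
    rw [hA, hBanti.measure_iInter (fun k => (hBmeas k).nullMeasurableSet)
      ⟨0, measure_ne_top P _⟩]
    exact le_iInf fun k => (hN k).le.trans
      (measure_mono fun ω hω => subset_closure (mem_image_of_mem f hω))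
  have hPA1 : P A = 1 := (hset.ergodic A hAmeas hinv).resolve_left fun h => by
    rw [h] at hPA
    simp at hPA
  refine ⟨A, hAmeas, hPA1, fun η hη => ?_⟩
  obtain ⟨k, hk⟩ := exists_nat_one_div_lt (half_pos hη)
  refine ⟨1 / ((N k : ℝ) + 1), Nat.one_div_pos_of_nat, fun ε hε hε1 t ht ω hω x y hxy => ?_⟩
  rw [hAC] at hω
  have hosc : ∀ x y, |x - y| ≤ 1 / ((N k : ℝ) + 1) →
      |u θ ω (t / ε) x - u θ ω (t / ε) y| ≤ 1 / ((k : ℝ) + 1) := fun x y h =>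
    mem_iInter.1 hω k (t / ε, x) (div_nonneg ht hε.le) (t / ε, y) (div_nonneg ht hε.le)
      (by rwa [Prod.dist_eq, dist_self, max_eq_right dist_nonneg, Real.dist_eq])
  have := abs_rescale_sub_le (g := fun x => u θ ω (t / ε) x) Nat.one_div_pos_of_nat hosc hε
    hε1 hxy
  linarith
end
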